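/- arXiv:1802.02002 — 3 statements merged into one kernel-verified Lean document; each statement's English description precedes it below -/
import Mathlib

section
/- For every r ∈ ℕ there exist reals c_1, c_2, C > 0 and n_0 ∈ ℕ such that for all n ≥ n_0: the number of integer partitions of n with every part at least 2r+2 whose largest part lies outside the interval [c_1·√n·log n, c_2·√n·log n] is at most (C/n²)·p_{≥2r+2}(n), where p_{≥2r+2}(n) denotes the number of integer partitions of n with every part at least 2r+2 (and p_{≥2r+2}(n) ≥ 1 for n ≥ n_0). -/
/-- Multisets with sum `z` all of whose elements lie in `[m, M]`. -/
def boundedParts (m M : ℕ) (z : ℤ) : Set (Multiset ℕ) :=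
  {s | (s.sum : ℤ) = z ∧ ∀ i ∈ s, m ≤ i ∧ i ≤ M}

/-- The number of partitions of `z` into parts in `[m, M]`. -/
noncomputable def numBoundedParts (m M : ℕ) (z : ℤ) : ℕ := (boundedParts m M z).ncard

lemma finite_boundedParts {m : ℕ} (hm : 0 < m) (M : ℕ) (z : ℤ) :
    (boundedParts m M z).Finite := by
  refine (Set.finite_range (fun p : z.toNat.Partition => p.parts)).subset ?_
  rintro s ⟨h1, h2⟩
  exact ⟨⟨s, fun {i} hi => hm.trans_le (h2 i hi).1, by omega⟩, rfl⟩

lemma ncard_le_count_boundedParts {m M k : ℕ} (hk : m ≤ k ∧ k ≤ M) (j : ℕ) (z : ℤ) :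
    {s ∈ boundedParts m M z | j ≤ s.count k}.ncard = numBoundedParts m M (z - j * k) := by
  rw [numBoundedParts, ← Set.ncard_image_of_injective (boundedParts m M (z - j * k))
    (add_left_injective (Multiset.replicate j k))]
  congr 1
  ext s
  simp only [Set.mem_ofPred_eq, Set.mem_image, boundedParts]
  constructor
  · rintro ⟨⟨h1, h2⟩, h3⟩
    have hle := Multiset.le_count_iff_replicate_le.1 h3
    refine ⟨s - Multiset.replicate j k, ⟨?_, fun i hi => h2 i (Multiset.mem_of_le
      (Multiset.sub_le_self _ _) hi)⟩, tsub_add_cancel_of_le hle⟩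
    have := congrArg Multiset.sum (tsub_add_cancel_of_le hle)
    simp only [Multiset.sum_add, Multiset.sum_replicate, smul_eq_mul] at this
    rw [← h1, ← this]
    push_cast
    ring
  · rintro ⟨t, ⟨h1, h2⟩, rfl⟩
    refine ⟨⟨?_, fun i hi => ?_⟩, ?_⟩
    · rw [Multiset.sum_add, Multiset.sum_replicate, smul_eq_mul, Nat.cast_add, h1]
      push_cast
      ring
    · rcases Multiset.mem_add.1 hi with hi | hi
      · exact h2 i hi
      · rwa [Multiset.eq_of_mem_replicate hi]
    · simp

lemma numBoundedParts_sub_mul_le {m M k : ℕ} (hm : 0 < m) (hk : m ≤ k ∧ k ≤ M) (j : ℕ) (z : ℤ) :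
    numBoundedParts m M (z - j * k) ≤ numBoundedParts m M z := by
  rw [← ncard_le_count_boundedParts hk]
  exact Set.ncard_le_ncard (Set.sep_subset _ _) (finite_boundedParts hm M z)

lemma numBoundedParts_le_of_sq_le {m M : ℕ} (hm : 0 < m) (hM : m + 1 ≤ M) {y z : ℤ}
    (h : y + (m : ℤ) ^ 2 ≤ z) : numBoundedParts m M y ≤ numBoundedParts m M z := by
  obtain ⟨d, hd⟩ := Int.le.dest ((le_add_of_nonneg_right (sq_nonneg (m : ℤ))).trans h)
  subst hd
  have hd : m ^ 2 ≤ d := by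
    have : (m : ℤ) ^ 2 ≤ d := by linarith
    exact_mod_cast this
  have h1 : m ≤ d / m := by
    rw [Nat.le_div_iff_mul_le hm]
    nlinarith
  obtain ⟨a, ha⟩ := Nat.exists_eq_add_of_le ((Nat.mod_lt d hm).le.trans h1)
  have h2 : (d : ℤ) = a * m + (d % m : ℕ) * (m + 1 : ℕ) := by
    have := Nat.div_add_mod d m
    rw [ha] at this
    conv_lhs => rw [← this]
    push_cast
    ring
  calc numBoundedParts m M y
      = numBoundedParts m M (y + d - a * m - (d % m : ℕ) * (m + 1 : ℕ)) := by
        congr 1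
        rw [h2]
        ring
    _ ≤ numBoundedParts m M (y + d - a * m) :=
        numBoundedParts_sub_mul_le hm ⟨by omega, hM⟩ _ _
    _ ≤ _ := numBoundedParts_sub_mul_le hm ⟨le_rfl, by omega⟩ _ _

lemma sq_card_le_two_mul_sum (t : Finset ℕ) (ht : 0 ∉ t) : t.card ^ 2 ≤ 2 * ∑ i ∈ t, i := by
  induction t using Finset.induction_on_max with
  | empty => simp
  | insert a t hlt ih =>
    have ha : a ∉ t := fun h => (hlt a h).false
    rw [Finset.card_insert_of_notMem ha, Finset.sum_insert ha]
    have h1 := ih fun h => ht (Finset.mem_insert_of_mem h)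
    have h2 : t ⊆ Finset.Ico 1 a := fun i hi => by
      have : i ≠ 0 := fun h => ht (Finset.mem_insert_of_mem (h ▸ hi))
      exact Finset.mem_Ico.2 ⟨by omega, hlt i hi⟩
    have h3 := Finset.card_le_card h2
    have h4 : a ≠ 0 := fun h => ht (h ▸ Finset.mem_insert_self _ _)
    rw [Nat.card_Ico] at h3
    have h5 : t.card + 1 ≤ a := by omega
    nlinarith

lemma sum_numBoundedParts_sub_le {m M D : ℕ} (hm : 0 < m) {z : ℤ} (hD : 2 * z < (D + 1 : ℤ) ^ 2) :
    ∑ k ∈ Finset.Icc m M, numBoundedParts m M (z - k) ≤ D * numBoundedParts m M z := by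
  classical
  set F := (finite_boundedParts hm M z).toFinset with hF
  have hcard : numBoundedParts m M z = F.card :=
    Set.ncard_eq_toFinset_card _ (finite_boundedParts hm M z)
  have hmem : ∀ s, s ∈ F ↔ s ∈ boundedParts m M z := by simp [hF]
  calc ∑ k ∈ Finset.Icc m M, numBoundedParts m M (z - k)
      = ∑ k ∈ Finset.Icc m M, (F.filter fun s => k ∈ s).card := by
        refine Finset.sum_congr rfl fun k hk => ?_
        have h := ncard_le_count_boundedParts (Finset.mem_Icc.1 hk) 1 z
        rw [Nat.cast_one, one_mul] at h
        rw [← h, ← Set.ncard_coe_finset]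
        congr 1
        ext s
        simp [hmem, Multiset.one_le_count_iff_mem]
    _ = ∑ s ∈ F, ((Finset.Icc m M).filter fun k => k ∈ s).card :=
        Finset.sum_card_bipartiteAbove_eq_sum_card_bipartiteBelow fun k s => k ∈ s
    _ ≤ ∑ s ∈ F, D := by
        refine Finset.sum_le_sum fun s hs => ?_
        obtain ⟨h1, h2⟩ := (hmem s).1 hs
        set t := (Finset.Icc m M).filter fun k => k ∈ s
        have h3 := sq_card_le_two_mul_sum t (by simp [t]; omega)
        have h4 : ∑ i ∈ t, i ≤ s.sum := by
          have : t.val ≤ s := (Multiset.le_iff_subset t.nodup).2 fun i hi =>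
            (Finset.mem_filter.1 (Finset.mem_val (s := t) ▸ hi)).2
          obtain ⟨u, hu⟩ := Multiset.le_iff_exists_add.1 this
          rw [hu, Multiset.sum_add, Finset.sum_eq_multiset_sum, Multiset.map_id']
          exact Nat.le_add_right _ _
        by_contra! h5
        have h6 : (D + 1) ^ 2 ≤ t.card ^ 2 := Nat.pow_le_pow_left h5 2
        zify at h3 h4 h6
        push_cast at *
        linarith
    _ = D * numBoundedParts m M z := by rw [Finset.sum_const, smul_eq_mul, hcard, mul_comm]

lemma mul_numBoundedParts_eq_sum {m M : ℕ} (hm : 0 < m) (n : ℕ) :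
    n * numBoundedParts m M n = ∑ k ∈ Finset.Icc m M, ∑ j ∈ Finset.Icc 1 n,
      k * numBoundedParts m M (n - j * k) := by
  classical
  set F := (finite_boundedParts hm M n).toFinset with hF
  have hcard : numBoundedParts m M n = F.card :=
    Set.ncard_eq_toFinset_card _ (finite_boundedParts hm M n)
  have hmem : ∀ s, s ∈ F ↔ s ∈ boundedParts m M n := by simp [hF]
  have hsum : ∀ s ∈ F, ∑ k ∈ Finset.Icc m M, k * s.count k = n := by
    intro s hs
    obtain ⟨h1, h2⟩ := (hmem s).1 hs
    rw [Nat.cast_inj] at h1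
    rw [← h1, Finset.sum_multiset_count_of_subset s (Finset.Icc m M)]
    · simp [mul_comm]
    · intro k hk
      simpa using h2 k (by simpa using hk)
  have hcount : ∀ s ∈ F, ∀ k, s.count k ≤ n := by
    intro s hs k
    obtain ⟨h1, h2⟩ := (hmem s).1 hs
    rw [Nat.cast_inj] at h1
    have := Multiset.card_nsmul_le_sum (s := s) (a := 1) fun i hi => hm.trans_le (h2 i hi).1
    have h3 := Multiset.count_le_card k s
    simp at this
    omega
  calc n * numBoundedParts m M n = ∑ s ∈ F, ∑ k ∈ Finset.Icc m M, k * s.count k := by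
        rw [Finset.sum_congr rfl hsum, Finset.sum_const, smul_eq_mul, hcard, mul_comm]
    _ = ∑ k ∈ Finset.Icc m M, k * ∑ s ∈ F, ((Finset.Icc 1 n).filter fun j => j ≤ s.count k).card := by
        rw [Finset.sum_comm]
        refine Finset.sum_congr rfl fun k _ => ?_
        rw [Finset.mul_sum]
        refine Finset.sum_congr rfl fun s hs => ?_
        have : ((Finset.Icc 1 n).filter fun j => j ≤ s.count k) = Finset.Icc 1 (s.count k) := by
          ext j
          have := hcount s hs k
          simp only [Finset.mem_filter, Finset.mem_Icc]
          omega
        rw [this, Nat.card_Icc, Nat.add_sub_cancel]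
    _ = ∑ k ∈ Finset.Icc m M, k * ∑ j ∈ Finset.Icc 1 n, (F.filter fun s => j ≤ s.count k).card := by
        refine Finset.sum_congr rfl fun k _ => ?_
        congr 1
        exact (Finset.sum_card_bipartiteAbove_eq_sum_card_bipartiteBelow
          fun (j : ℕ) (s : Multiset ℕ) => j ≤ s.count k).symm
    _ = _ := by
        refine Finset.sum_congr rfl fun k hk => ?_
        rw [Finset.mul_sum]
        refine Finset.sum_congr rfl fun j _ => ?_
        congr 1
        rw [← ncard_le_count_boundedParts (Finset.mem_Icc.1 hk), ← Set.ncard_coe_finset]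
        congr 1
        ext s
        simp [hmem]

lemma sum_ite_mul_le_sq {m : ℕ} (hm : 0 < m) (M n x : ℕ) :
    ∑ k ∈ Finset.Icc m M, ∑ j ∈ Finset.Icc 1 n, (if j * k ≤ x then k else 0) ≤ x ^ 2 := by
  have h1 : ∀ k ∈ Finset.Icc m M, ∑ j ∈ Finset.Icc 1 n, (if j * k ≤ x then k else 0) ≤
      if k ∈ Finset.Icc 1 x then x else 0 := by
    intro k hk
    have hk0 : 0 < k := hm.trans_le (Finset.mem_Icc.1 hk).1
    have h2 : (Finset.Icc 1 n).filter (fun j => j * k ≤ x) ⊆ Finset.Icc 1 (x / k) := by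
      intro j hj
      simp only [Finset.mem_filter, Finset.mem_Icc] at hj ⊢
      exact ⟨hj.1.1, (Nat.le_div_iff_mul_le hk0).2 hj.2⟩
    have h3 := Finset.card_le_card h2
    rw [Nat.card_Icc, Nat.add_sub_cancel] at h3
    rw [← Finset.sum_filter, Finset.sum_const, smul_eq_mul]
    split_ifs with h
    · exact (Nat.mul_le_mul_right k h3).trans (Nat.div_mul_le_self x k)
    · have : x / k = 0 := Nat.div_eq_of_lt (by simp at h; omega)
      simp [Nat.le_zero.1 (this ▸ h3)]
  calc _ ≤ ∑ k ∈ Finset.Icc m M, (if k ∈ Finset.Icc 1 x then x else 0) := Finset.sum_le_sum h1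
    _ = ((Finset.Icc m M).filter (· ∈ Finset.Icc 1 x)).card * x := by
      rw [← Finset.sum_filter, Finset.sum_const, smul_eq_mul]
    _ ≤ x * x := by
      refine Nat.mul_le_mul_right x ((Finset.card_le_card fun i hi => ?_).trans_eq
        ((Nat.card_Icc 1 x).trans (Nat.add_sub_cancel _ _)))
      exact (Finset.mem_filter.1 hi).2
    _ = x ^ 2 := (sq x).symm

lemma two_mul_numBoundedParts_sub_le {m M R : ℕ} (hm : 0 < m) (hR : m ^ 2 ≤ R) (hM : 26 * R ≤ M)
    {z : ℤ} (hz : z ≤ 64 * (R : ℤ) ^ 2) :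
    2 * numBoundedParts m M (z - 26 * R) ≤ numBoundedParts m M z := by
  have hmR : m ≤ R := (Nat.le_self_pow two_ne_zero m).trans hR
  have h1 := sum_numBoundedParts_sub_le (M := M) (D := 12 * R) hm (z := z) (by push_cast; nlinarith)
  have h2 : ∑ k ∈ Finset.Icc m (25 * R), numBoundedParts m M (z - 26 * R) ≤
      ∑ k ∈ Finset.Icc m M, numBoundedParts m M (z - k) := by
    refine (Finset.sum_le_sum fun k hk => ?_).trans (Finset.sum_le_sum_of_subset
      (Finset.Icc_subset_Icc_right (by omega : 25 * R ≤ M)))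
    refine numBoundedParts_le_of_sq_le hm (by omega) ?_
    have := (Finset.mem_Icc.1 hk).2
    zify at this hR
    linarith
  rw [Finset.sum_const, Nat.card_Icc, smul_eq_mul] at h2
  have h3 : 24 * R ≤ 25 * R + 1 - m := by omega
  have h4 := (Nat.mul_le_mul_right (numBoundedParts m M (z - 26 * R)) h3).trans (h2.trans h1)
  have h5 : 0 < 12 * R := by omega
  refine Nat.le_of_mul_le_mul_left ?_ h5
  linarith

lemma two_pow_mul_numBoundedParts_sub_le {m M R : ℕ} (hm : 0 < m) (hR : m ^ 2 ≤ R)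
    (hM : 26 * R ≤ M) {z : ℤ} (hz : z ≤ 64 * (R : ℤ) ^ 2) (i : ℕ) :
    2 ^ i * numBoundedParts m M (z - i * (26 * R)) ≤ numBoundedParts m M z := by
  induction i with
  | zero => simp
  | succ i ih =>
    have h := two_mul_numBoundedParts_sub_le hm hR hM (z := z - i * (26 * R))
      (by nlinarith [mul_nonneg (Int.natCast_nonneg i) (Int.natCast_nonneg R)])
    rw [show z - i * (26 * R) - 26 * R = z - (i + 1 : ℕ) * (26 * R) by push_cast; ring] at h
    calc _ = 2 ^ i * (2 * numBoundedParts m M (z - (i + 1 : ℕ) * (26 * R))) := by ring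
      _ ≤ _ := (Nat.mul_le_mul_left _ h).trans ih

lemma sum_sq_div_two_pow_le (L : ℕ) :
    ∑ l ∈ Finset.range L, ((l : ℝ) + 21) ^ 2 / 2 ^ (l + 19) ≤ 1944 / 2 ^ 20 := by
  have h : ∑ l ∈ Finset.range L, ((l : ℝ) + 21) ^ 2 / 2 ^ (l + 19) =
      1944 / 2 ^ 20 - (4 * ((L : ℝ) + 20) ^ 2 + 16 * (L + 20) + 24) / 2 ^ (L + 20) := by
    induction L with
    | zero => norm_num
    | succ L ih =>
      rw [Finset.sum_range_succ, ih]
      push_cast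
      field_simp
      ring
  rw [h]
  have : 0 ≤ (4 * ((L : ℝ) + 20) ^ 2 + 16 * (L + 20) + 24) / 2 ^ (L + 20) := by positivity
  linarith

lemma numBoundedParts_le_mul_sub {m M R n : ℕ} (hm : 0 < m) (hR : m ^ 2 ≤ R) (hM : 26 * R ≤ M)
    (hn : 16 * R ^ 2 ≤ n) (hn' : n ≤ 64 * R ^ 2) :
    numBoundedParts m M n ≤ 33800 * numBoundedParts m M (n - R) := by
  have hmR : m ≤ R := (Nat.le_self_pow two_ne_zero m).trans hR
  have hR0 : 0 < R := by omega
  have hm1 : m + 1 ≤ M := by omega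
  set q : ℤ → ℝ := fun z => numBoundedParts m M z with hq
  have hq0 : ∀ z, 0 ≤ q z := fun z => Nat.cast_nonneg _
  set c : ℕ → ℕ → ℕ → ℝ := fun x k j => ((if j * k ≤ x then k else 0 : ℕ) : ℝ) with hc
  have hc0 : ∀ x k j, 0 ≤ c x k j := fun x k j => Nat.cast_nonneg _
  have hcsum : ∀ x : ℕ, ∑ k ∈ Finset.Icc m M, ∑ j ∈ Finset.Icc 1 n, c x k j ≤ (x : ℝ) ^ 2 :=
    fun x => by
      have := sum_ite_mul_le_sq hm M n x
      simp only [hc]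
      exact_mod_cast this
  have hpt : ∀ k ∈ Finset.Icc m M, ∀ j ∈ Finset.Icc 1 n, (k : ℝ) * q (n - j * k) ≤
      c (2 * R) k j * q n + c (520 * R) k j * q (n - R) +
        ∑ l ∈ Finset.range (n * M), c ((l + 21) * (26 * R)) k j * (q n / 2 ^ (l + 19)) := by
    intro k hk j hj
    rw [Finset.mem_Icc] at hk hj
    have hk0 : (0 : ℝ) ≤ k := Nat.cast_nonneg _
    have t1 : 0 ≤ c (2 * R) k j * q n := mul_nonneg (hc0 _ _ _) (hq0 _)
    have t2 : 0 ≤ c (520 * R) k j * q (n - R) := mul_nonneg (hc0 _ _ _) (hq0 _)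
    have t3' : ∀ l ∈ Finset.range (n * M),
        0 ≤ c ((l + 21) * (26 * R)) k j * (q n / 2 ^ (l + 19)) :=
      fun l _ => mul_nonneg (hc0 _ _ _) (div_nonneg (hq0 _) (by positivity))
    have t3 := Finset.sum_nonneg t3'
    rcases le_or_gt (j * k) (2 * R) with h1 | h1
    · have h2 : q (n - j * k) ≤ q n := Nat.cast_le.2 (numBoundedParts_sub_mul_le hm hk j n)
      have h3 : c (2 * R) k j = k := by simp [hc, h1]
      rw [h3] at t1 ⊢
      have := mul_le_mul_of_nonneg_left h2 hk0
      linarith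
    rcases le_or_gt (j * k) (520 * R) with h2 | h2
    · have h3 : q (n - j * k) ≤ q (n - R) := by
        refine Nat.cast_le.2 (numBoundedParts_le_of_sq_le hm hm1 ?_)
        zify at h1 hR
        linarith
      have h4 : c (520 * R) k j = k := by simp [hc, h2]
      rw [h4] at t2 ⊢
      have := mul_le_mul_of_nonneg_left h3 hk0
      linarith
    · have hH : 0 < 26 * R := by omega
      obtain ⟨l, hl⟩ : ∃ l, j * k / (26 * R) = l + 20 :=
        ⟨j * k / (26 * R) - 20, (Nat.sub_add_cancel ((Nat.le_div_iff_mul_le hH).2 (by omega))).symm⟩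
      have hlt := Nat.lt_div_mul_add (a := j * k) hH
      have hle := Nat.div_mul_le_self (j * k) (26 * R)
      rw [hl] at hlt hle
      have hl' : l ∈ Finset.range (n * M) := by
        rw [Finset.mem_range]
        have := Nat.div_le_self (j * k) (26 * R)
        have := Nat.mul_le_mul hj.2 hk.2
        omega
      have h3 : q (n - j * k) ≤ q n / 2 ^ (l + 19) := by
        rw [le_div_iff₀' (by positivity)]
        have h4 := two_pow_mul_numBoundedParts_sub_le hm hR hM (z := n) (by exact_mod_cast hn')
          (l + 19)
        have h5 : numBoundedParts m M (n - j * k) ≤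
            numBoundedParts m M (n - (l + 19 : ℕ) * (26 * R)) := by
          refine numBoundedParts_le_of_sq_le hm hm1 ?_
          zify at hle hR
          push_cast
          linarith
        have := (Nat.mul_le_mul_left (2 ^ (l + 19)) h5).trans h4
        simp only [hq]
        exact_mod_cast this
      have h4 : c ((l + 21) * (26 * R)) k j = k := by
        have : j * k ≤ (l + 21) * (26 * R) := by linarith
        simp [hc, this]
      have h5 := Finset.single_le_sum t3' hl'
      rw [h4] at h5
      have := mul_le_mul_of_nonneg_left h3 hk0
      linarith
  have hmain : (n : ℝ) * q n ≤ ((2 * R : ℕ) : ℝ) ^ 2 * q n + ((520 * R : ℕ) : ℝ) ^ 2 * q (n - R) +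
      ∑ l ∈ Finset.range (n * M), (((l + 21) * (26 * R) : ℕ) : ℝ) ^ 2 * (q n / 2 ^ (l + 19)) := by
    have h1 : (n : ℝ) * q n = ∑ k ∈ Finset.Icc m M, ∑ j ∈ Finset.Icc 1 n,
        (k : ℝ) * q (n - j * k) := by
      have := mul_numBoundedParts_eq_sum (M := M) hm n
      simp only [hq]
      exact_mod_cast this
    rw [h1]
    refine (Finset.sum_le_sum fun k hk => Finset.sum_le_sum (hpt k hk)).trans ?_
    simp only [Finset.sum_add_distrib, ← Finset.sum_mul]
    refine add_le_add (add_le_add ?_ ?_) ?_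
    · exact mul_le_mul_of_nonneg_right (hcsum _) (hq0 _)
    · exact mul_le_mul_of_nonneg_right (hcsum _) (hq0 _)
    · have h2 : ∀ k ∈ Finset.Icc m M, ∑ j ∈ Finset.Icc 1 n, ∑ l ∈ Finset.range (n * M),
          c ((l + 21) * (26 * R)) k j * (q n / 2 ^ (l + 19)) = ∑ l ∈ Finset.range (n * M),
          ∑ j ∈ Finset.Icc 1 n, c ((l + 21) * (26 * R)) k j * (q n / 2 ^ (l + 19)) :=
        fun k _ => Finset.sum_comm
      rw [Finset.sum_congr rfl h2, Finset.sum_comm]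
      refine Finset.sum_le_sum fun l _ => ?_
      simp only [← Finset.sum_mul]
      exact mul_le_mul_of_nonneg_right (hcsum _) (div_nonneg (hq0 _) (by positivity))
  have htail : ∑ l ∈ Finset.range (n * M),
      (((l + 21) * (26 * R) : ℕ) : ℝ) ^ 2 * (q n / 2 ^ (l + 19)) ≤
      676 * (R : ℝ) ^ 2 * q n * (1944 / 2 ^ 20) := by
    refine le_trans (le_of_eq ?_) (mul_le_mul_of_nonneg_left (sum_sq_div_two_pow_le (n * M))
      (mul_nonneg (by positivity) (hq0 n)))
    rw [Finset.mul_sum]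
    refine Finset.sum_congr rfl fun l _ => ?_
    push_cast
    ring
  have hnR : 16 * (R : ℝ) ^ 2 * q n ≤ n * q n :=
    mul_le_mul_of_nonneg_right (by exact_mod_cast hn) (hq0 _)
  have hfin : (R : ℝ) ^ 2 * q n ≤ (R : ℝ) ^ 2 * (33800 * q (n - R)) := by
    push_cast at hmain htail
    have := mul_nonneg (sq_nonneg (R : ℝ)) (hq0 n)
    linarith
  have := le_of_mul_le_mul_left hfin (by positivity)
  simp only [hq] at this
  exact_mod_cast this

lemma numBoundedParts_le_pow_mul_sub {m M R n : ℕ} (hm : 0 < m) (hR : m ^ 2 ≤ R)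
    (hM : 26 * R ≤ M) (hn' : n ≤ 64 * R ^ 2) (t : ℕ) (ht : 16 * R ^ 2 + t * R ≤ n) :
    numBoundedParts m M n ≤ 33800 ^ t * numBoundedParts m M (n - t * R) := by
  induction t with
  | zero => simp
  | succ t ih =>
    rw [add_one_mul] at ht
    have h := numBoundedParts_le_mul_sub hm hR hM (n := n - t * R) (by omega) (by omega)
    rw [Nat.cast_sub (by omega)] at h
    refine (ih (by omega)).trans ?_
    rw [pow_succ, mul_assoc]
    refine Nat.mul_le_mul_left _ (h.trans_eq ?_)
    congr 2
    push_cast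
    ring

lemma mul_numBoundedParts_le {m M R n : ℕ} (hm : 0 < m) (hR : m ^ 2 ≤ R)
    (hM : 26 * R ≤ M) (hM' : M ≤ 7 * R ^ 2) (hn : 32 * R ^ 2 ≤ n) (hn' : n ≤ 64 * R ^ 2) :
    R * numBoundedParts m M n ≤ 33800 ^ (2 * M / R + 2) * numBoundedParts m (2 * M) n := by
  classical
  have hmR : m ≤ R := (Nat.le_self_pow two_ne_zero m).trans hR
  have hR0 : 0 < R := by omega
  have hfin := finite_boundedParts hm
  have h1 := Nat.div_mul_le_self (2 * M) R
  have h2 := Nat.lt_div_mul_add (a := 2 * M) hR0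
  have hstep := numBoundedParts_le_pow_mul_sub hm hR hM hn' (2 * M / R + 2) (by
    rw [add_mul]
    nlinarith)
  set t := 2 * M / R + 2 with ht
  have h3 : ∀ k ∈ Finset.Ioc M (2 * M), numBoundedParts m M n ≤
      33800 ^ t * numBoundedParts m M (n - k) := by
    intro k hk
    refine hstep.trans (Nat.mul_le_mul_left _ (numBoundedParts_le_of_sq_le hm (by omega) ?_))
    have : k + m ^ 2 ≤ t * R := by
      rw [ht, add_mul]
      have := (Finset.mem_Ioc.1 hk).2
      omega
    zify at this
    linarith
  have h4 : ∑ k ∈ Finset.Ioc M (2 * M), numBoundedParts m M (n - k) ≤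
      numBoundedParts m (2 * M) n := by
    have hcard : ∀ k : ℕ, numBoundedParts m M (n - k) =
        ((hfin M (n - k)).toFinset.image (k ::ₘ ·)).card := fun k => by
      rw [Finset.card_image_of_injective _ (fun _ _ => (Multiset.cons_inj_right k).1), numBoundedParts,
        Set.ncard_eq_toFinset_card _ (hfin M (n - k))]
    rw [Finset.sum_congr rfl fun k _ => hcard k, ← Finset.card_biUnion]
    · rw [numBoundedParts, Set.ncard_eq_toFinset_card _ (hfin (2 * M) n)]
      refine Finset.card_le_card fun s hs => ?_
      simp only [Finset.mem_biUnion, Finset.mem_image, Set.Finite.mem_toFinset] at hs ⊢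
      obtain ⟨k, hk, u, ⟨hu1, hu2⟩, rfl⟩ := hs
      rw [Finset.mem_Ioc] at hk
      refine ⟨by rw [Multiset.sum_cons, Nat.cast_add, hu1]; ring, fun i hi => ?_⟩
      rcases Multiset.mem_cons.1 hi with rfl | hi
      · omega
      · have := hu2 i hi
        omega
    · intro k hk l hl hkl
      refine Finset.disjoint_left.2 fun s hs hs' => hkl ?_
      simp only [Finset.mem_image, Set.Finite.mem_toFinset] at hs hs'
      obtain ⟨u, ⟨hu1, hu2⟩, rfl⟩ := hs
      obtain ⟨v, ⟨hv1, hv2⟩, huv⟩ := hs'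
      have hkm : k ∈ l ::ₘ v := huv ▸ Multiset.mem_cons_self k u
      rcases Multiset.mem_cons.1 hkm with h | h
      · exact h
      · have := (hv2 k h).2
        have := (Finset.mem_Ioc.1 (Finset.mem_coe.1 hk)).1
        omega
  calc R * numBoundedParts m M n ≤ M * numBoundedParts m M n := Nat.mul_le_mul_right _ (by omega)
    _ = ∑ k ∈ Finset.Ioc M (2 * M), numBoundedParts m M n := by
      rw [Finset.sum_const, Nat.card_Ioc, smul_eq_mul]
      congr 1
      omega
    _ ≤ ∑ k ∈ Finset.Ioc M (2 * M), 33800 ^ t * numBoundedParts m M (n - k) :=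
      Finset.sum_le_sum h3
    _ ≤ _ := by
      rw [← Finset.mul_sum]
      exact Nat.mul_le_mul_left _ h4

lemma pow_mul_numBoundedParts_le {m L R n : ℕ} (hm : 0 < m) (hR : m ^ 2 ≤ R)
    (hL : 26 * R ≤ L) (hL' : 16 * L ≤ 7 * R ^ 2) (hn : 32 * R ^ 2 ≤ n) (hn' : n ≤ 64 * R ^ 2) :
    R ^ 5 * numBoundedParts m L n ≤ 33800 ^ (62 * L / R + 10) * numBoundedParts m (32 * L) n := by
  have h1 := mul_numBoundedParts_le hm hR (M := L) (by omega) (by omega) hn hn'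
  have h2 := mul_numBoundedParts_le hm hR (M := 2 * L) (by omega) (by omega) hn hn'
  have h3 := mul_numBoundedParts_le hm hR (M := 4 * L) (by omega) (by omega) hn hn'
  have h4 := mul_numBoundedParts_le hm hR (M := 8 * L) (by omega) (by omega) hn hn'
  have h5 := mul_numBoundedParts_le hm hR (M := 16 * L) (by omega) (by omega) hn hn'
  simp only [← mul_assoc, Nat.reduceMul] at h1 h2 h3 h4 h5
  have hR0 : 0 < R := by
    have := pow_pos hm 2
    omega
  have he : (2 * L / R + 2) + (4 * L / R + 2) + (8 * L / R + 2) + (16 * L / R + 2) +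
      (32 * L / R + 2) ≤ 62 * L / R + 10 := by
    have : 2 * L / R + 4 * L / R + 8 * L / R + 16 * L / R + 32 * L / R ≤ 62 * L / R := by
      rw [Nat.le_div_iff_mul_le hR0]
      have a1 := Nat.div_mul_le_self (2 * L) R
      have a2 := Nat.div_mul_le_self (4 * L) R
      have a3 := Nat.div_mul_le_self (8 * L) R
      have a4 := Nat.div_mul_le_self (16 * L) R
      have a5 := Nat.div_mul_le_self (32 * L) R
      linarith
    omega
  refine le_trans ?_ (Nat.mul_le_mul_right _ (Nat.pow_le_pow_right (by norm_num) he))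
  rw [pow_add _ (_ + _) (32 * L / R + 2), pow_add _ (_ + _) (16 * L / R + 2),
    pow_add _ (_ + _) (8 * L / R + 2), pow_add _ (_ + 2) (4 * L / R + 2)]
  generalize 33800 ^ (2 * L / R + 2) = k₁ at *
  generalize 33800 ^ (4 * L / R + 2) = k₂ at *
  generalize 33800 ^ (8 * L / R + 2) = k₃ at *
  generalize 33800 ^ (16 * L / R + 2) = k₄ at *
  generalize 33800 ^ (32 * L / R + 2) = k₅ at *
  calc R ^ 5 * numBoundedParts m L n = R ^ 4 * (R * numBoundedParts m L n) := by ring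
    _ ≤ R ^ 4 * (k₁ * numBoundedParts m (2 * L) n) := by gcongr
    _ = R ^ 3 * k₁ * (R * numBoundedParts m (2 * L) n) := by ring
    _ ≤ R ^ 3 * k₁ * (k₂ * numBoundedParts m (4 * L) n) := by gcongr
    _ = R ^ 2 * k₁ * k₂ * (R * numBoundedParts m (4 * L) n) := by ring
    _ ≤ R ^ 2 * k₁ * k₂ * (k₃ * numBoundedParts m (8 * L) n) := by gcongr
    _ = R * k₁ * k₂ * k₃ * (R * numBoundedParts m (8 * L) n) := by ring
    _ ≤ R * k₁ * k₂ * k₃ * (k₄ * numBoundedParts m (16 * L) n) := by gcongr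
    _ = k₁ * k₂ * k₃ * k₄ * (R * numBoundedParts m (16 * L) n) := by ring
    _ ≤ k₁ * k₂ * k₃ * k₄ * (k₅ * numBoundedParts m (32 * L) n) := by gcongr
    _ = _ := by ring

lemma card_partition_eq_ncard (n m : ℕ) (hm : 0 < m) (Q : Multiset ℕ → Prop) :
    Nat.card {p : n.Partition // (∀ j ∈ p.parts, m ≤ j) ∧ Q p.parts} =
      {s ∈ boundedParts m n n | Q s}.ncard := by
  have hinj : Function.Injective fun p : n.Partition => p.parts := fun p q h =>
    Nat.Partition.ext h
  rw [← Set.coe_ofPred, Nat.card_coe_set_eq, ← Set.ncard_image_of_injective _ hinj]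
  congr 1
  ext s
  constructor
  · rintro ⟨p, ⟨h1, h2⟩, rfl⟩
    exact ⟨⟨by exact_mod_cast p.parts_sum, fun i hi =>
      ⟨h1 i hi, (Multiset.le_sum_of_mem hi).trans_eq p.parts_sum⟩⟩, h2⟩
  · rintro ⟨⟨h1, h2⟩, h3⟩
    exact ⟨⟨s, fun {i} hi => hm.trans_le (h2 i hi).1, by exact_mod_cast h1⟩,
      ⟨fun j hj => (h2 j hj).1, h3⟩, rfl⟩

lemma numBoundedParts_le_self {m : ℕ} (hm : 0 < m) (M n : ℕ) :
    numBoundedParts m M n ≤ numBoundedParts m n n := by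
  refine Set.ncard_le_ncard ?_ (finite_boundedParts hm n n)
  rintro s ⟨h1, h2⟩
  have h1' : s.sum = n := by exact_mod_cast h1
  exact ⟨h1, fun i hi => ⟨(h2 i hi).1, (Multiset.le_sum_of_mem hi).trans_eq h1'⟩⟩

lemma Multiset.sup_mem_of_pos (s : Multiset ℕ) (h : 0 < s.sup) : s.sup ∈ s := by
  induction s using Multiset.induction_on with
  | empty => simp at h
  | cons a s ih =>
    rw [Multiset.sup_cons] at h ⊢
    rcases le_total a s.sup with h' | h'
    · rw [sup_eq_right.2 h'] at h ⊢
      exact Multiset.mem_cons_of_mem (ih h)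
    · rw [sup_eq_left.2 h']
      exact Multiset.mem_cons_self a s

lemma ncard_sup_lt_or_lt_sup_le {m n : ℕ} (hm : 0 < m) {x y : ℝ} (hy : 0 ≤ y) :
    {s ∈ boundedParts m n n | (s.sup : ℝ) < x ∨ y < s.sup}.ncard ≤
      numBoundedParts m ⌊x⌋₊ n +
        ∑ k ∈ (Finset.Icc m n).filter (fun k : ℕ => y < (k : ℝ)), numBoundedParts m n (n - k) := by
  classical
  have h1 : {s ∈ boundedParts m n n | (s.sup : ℝ) < x ∨ y < s.sup} ⊆
      boundedParts m ⌊x⌋₊ n ∪ ⋃ k ∈ (Finset.Icc m n).filter (fun k : ℕ => y < (k : ℝ)),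
        {s ∈ boundedParts m n n | 1 ≤ s.count k} := by
    rintro s ⟨⟨h1, h2⟩, h | h⟩
    · exact Or.inl ⟨h1, fun i hi => ⟨(h2 i hi).1, Nat.le_floor
        ((Nat.cast_le.2 (Multiset.le_sup hi)).trans h.le)⟩⟩
    · right
      have hmem := s.sup_mem_of_pos (by exact_mod_cast hy.trans_lt h)
      simp only [Set.mem_iUnion]
      exact ⟨s.sup, Finset.mem_filter.2 ⟨Finset.mem_Icc.2 (h2 _ hmem), h⟩, ⟨h1, h2⟩,
        Multiset.one_le_count_iff_mem.2 hmem⟩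
  have hfin := finite_boundedParts hm n n
  refine (Set.ncard_le_ncard h1 ((finite_boundedParts hm _ _).union
    (Set.Finite.biUnion (Finset.finite_toSet _) fun k _ => hfin.subset (Set.sep_subset _ _)))).trans
    ((Set.ncard_union_le _ _).trans (Nat.add_le_add_left ?_ _))
  refine (Finset.set_ncard_biUnion_le _ _).trans (Finset.sum_le_sum fun k hk => ?_)
  have := ncard_le_count_boundedParts (Finset.mem_Icc.1 (Finset.mem_filter.1 hk).1) 1 n
  rw [Nat.cast_one, one_mul] at this
  exact this.le

lemma exists_sq_mul_le_le {n : ℕ} (hn : 500 ≤ n) : ∃ R : ℕ, 32 * R ^ 2 ≤ n ∧ n ≤ 64 * R ^ 2 := by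
  refine ⟨Nat.sqrt (n / 32), ?_, ?_⟩
  · have := Nat.sqrt_le' (n / 32)
    omega
  · have h1 := Nat.lt_succ_sqrt' (n / 32)
    have h2 : 3 ≤ Nat.sqrt (n / 32) := Nat.le_sqrt.2 (by omega)
    rw [Nat.succ_eq_add_one] at h1
    have h3 : n < 32 * (Nat.sqrt (n / 32) + 1) ^ 2 := by omega
    nlinarith

/-- **Theorem (the largest part of a random partition into parts `≥ 2r+2`).**
For every `r ∈ ℕ` there are `c₁, c₂, C > 0` and `n₀ ∈ ℕ` such that for all `n ≥ n₀`:
there is at least one partition of `n` with all parts at least `2r+2`, and the number of such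
partitions whose largest part lies outside `[c₁·√n·log n, c₂·√n·log n]` is at most
`(C/n²)` times the number of all partitions of `n` with all parts at least `2r+2`. -/
theorem largest_part_of_restricted_partition (r : ℕ) :
    ∃ c₁ c₂ C : ℝ, 0 < c₁ ∧ 0 < c₂ ∧ 0 < C ∧ ∃ n₀ : ℕ, ∀ n : ℕ, n₀ ≤ n →
      1 ≤ Nat.card {p : n.Partition // ∀ j ∈ p.parts, 2 * r + 2 ≤ j} ∧
      (Nat.card {p : n.Partition // (∀ j ∈ p.parts, 2 * r + 2 ≤ j) ∧
          ((p.parts.sup : ℝ) < c₁ * Real.sqrt n * Real.log n ∨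
            c₂ * Real.sqrt n * Real.log n < (p.parts.sup : ℝ))} : ℝ) ≤
        (C / (n : ℝ) ^ 2) *
          (Nat.card {p : n.Partition // ∀ j ∈ p.parts, 2 * r + 2 ≤ j} : ℝ) := by
  have hm : 0 < 2 * r + 2 := by omega
  set m := 2 * r + 2
  set κ := Real.log 33800 with hκ
  have hκ1 : 1 ≤ κ := by
    rw [hκ, Real.le_log_iff_exp_le (by norm_num)]
    linarith [Real.exp_one_lt_d9]
  set c₁ : ℝ := 1 / (992 * κ) with hc₁
  have hc₁0 : 0 < c₁ := by positivity
  have hc₁1 : c₁ ≤ 1 / 992 := one_div_le_one_div_of_le (by norm_num) (by linarith)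
  refine ⟨c₁, 40, 8 ^ 5 * 33800 ^ 10 + 1, hc₁0, by norm_num, by positivity,
    ⌈Real.exp (7 / c₁)⌉₊ + 64 * m ^ 4 + 500, fun n hn => ?_⟩
  obtain ⟨R, hR1, hR2⟩ := exists_sq_mul_le_le (n := n) (by omega)
  have hmR : m ^ 2 ≤ R := by
    by_contra! h
    have : R ^ 2 < m ^ 4 := (Nat.pow_lt_pow_left h two_ne_zero).trans_eq (by ring)
    omega
  have hcard : Nat.card {p : n.Partition // ∀ j ∈ p.parts, m ≤ j} = numBoundedParts m n n := by
    simpa [numBoundedParts] using card_partition_eq_ncard n m hm fun _ => True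
  have hm2n : m ^ 2 ≤ n := by nlinarith
  have hmn : m + 1 ≤ n := by
    have : 2 ≤ m := by omega
    nlinarith
  have hn0 : (0 : ℝ) < n := by exact_mod_cast (by omega : 0 < n)
  set s := Real.sqrt n with hs
  set ℓ := Real.log n with hℓ
  have hs0 : 0 < s := Real.sqrt_pos.2 hn0
  have hss : s ^ 2 = n := Real.sq_sqrt hn0.le
  have hs1 : 1 ≤ s := by
    rw [hs, Real.one_le_sqrt]
    exact_mod_cast (by omega : 1 ≤ n)
  have hℓc : 7 / c₁ ≤ ℓ := by
    rw [hℓ, Real.le_log_iff_exp_le hn0]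
    exact (Nat.le_ceil _).trans (by exact_mod_cast (by omega))
  have hℓ7 : 7 ≤ c₁ * ℓ := by rwa [div_le_iff₀' hc₁0] at hℓc
  have hℓ1 : 1 ≤ ℓ := by nlinarith
  have hℓs : ℓ ≤ 2 * s := by
    have h1 : ℓ = 2 * Real.log s := by rw [hℓ, ← hss, Real.log_pow]; norm_num
    linarith [Real.log_le_sub_one_of_pos hs0]
  have hsR : s ≤ 8 * R := by
    refine Real.sqrt_le_iff.2 ⟨by positivity, ?_⟩
    have : (n : ℝ) ≤ 64 * (R : ℝ) ^ 2 := by exact_mod_cast hR2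
    linarith
  have hRs : 5 * R ≤ s := by
    refine Real.le_sqrt_of_sq_le ?_
    have : 32 * (R : ℝ) ^ 2 ≤ n := by exact_mod_cast hR1
    nlinarith
  have hR0 : (0 : ℝ) < R := by linarith
  have hfloor := Nat.floor_le (by positivity : 0 ≤ c₁ * s * ℓ)
  have hfloor' := Nat.lt_floor_add_one (c₁ * s * ℓ)
  have hpos : 0 < numBoundedParts m n n := by
    have h0 : (0 : Multiset ℕ) ∈ boundedParts m n 0 := ⟨by simp, by simp⟩
    have h1 : 0 < numBoundedParts m n 0 :=
      (Set.ncard_pos (finite_boundedParts hm n 0)).2 ⟨0, h0⟩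
    exact h1.trans_le (numBoundedParts_le_of_sq_le hm hmn (by rw [zero_add]; exact_mod_cast hm2n))
  have hlow : (n : ℝ) ^ 2 * numBoundedParts m ⌊c₁ * s * ℓ⌋₊ n ≤
      8 ^ 5 * 33800 ^ 10 * numBoundedParts m n n := by
    set L := ⌊c₁ * s * ℓ⌋₊
    have h1 : 26 * R ≤ L := by
      have : 26 * (R : ℝ) ≤ L := by nlinarith
      exact_mod_cast this
    have h2 : 16 * L ≤ 7 * R ^ 2 := by
      have h3 : s ^ 2 ≤ (8 * R) ^ 2 := by gcongr
      have h4 : c₁ * s * ℓ ≤ 1 / 992 * s * (2 * s) := by gcongr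
      have : 16 * (L : ℝ) ≤ 7 * (R : ℝ) ^ 2 := by nlinarith
      exact_mod_cast this
    have h3 := (pow_mul_numBoundedParts_le hm hmR h1 h2 hR1 hR2).trans
      (Nat.mul_le_mul_left _ (numBoundedParts_le_self hm _ n))
    have h4 : (33800 : ℝ) ^ (62 * L / R) ≤ s := by
      have h5 : ((62 * L / R : ℕ) : ℝ) ≤ 496 * c₁ * ℓ := by
        refine Nat.cast_div_le.trans ?_
        rw [div_le_iff₀ hR0]
        push_cast
        have : c₁ * ℓ * s ≤ c₁ * ℓ * (8 * R) := by gcongr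
        linarith
      rw [← Real.log_le_log_iff (by positivity) hs0, Real.log_pow, hs, Real.log_sqrt hn0.le]
      calc _ ≤ 496 * c₁ * ℓ * κ := mul_le_mul_of_nonneg_right h5 (by linarith)
        _ = ℓ / 2 := by
          rw [hc₁]
          field_simp
          norm_num
    have h5 : (R : ℝ) ^ 5 * numBoundedParts m L n ≤
        33800 ^ (62 * L / R) * 33800 ^ 10 * numBoundedParts m n n := by
      rw [← pow_add]
      exact_mod_cast h3
    have h6 : s * ((n : ℝ) ^ 2 * numBoundedParts m L n) ≤
        s * (8 ^ 5 * 33800 ^ 10 * numBoundedParts m n n) :=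
      calc s * ((n : ℝ) ^ 2 * numBoundedParts m L n) = s ^ 5 * numBoundedParts m L n := by
            rw [← hss]
            ring
        _ ≤ (8 * (R : ℝ)) ^ 5 * numBoundedParts m L n := by gcongr
        _ = 8 ^ 5 * ((R : ℝ) ^ 5 * numBoundedParts m L n) := by ring
        _ ≤ 8 ^ 5 * ((33800 : ℝ) ^ (62 * L / R) * 33800 ^ 10 * numBoundedParts m n n) := by gcongr
        _ ≤ 8 ^ 5 * (s * 33800 ^ 10 * numBoundedParts m n n) := by gcongr
        _ = _ := by ring
    exact le_of_mul_le_mul_left h6 hs0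
  have hup : (n : ℝ) ^ 2 * ((∑ k ∈ (Finset.Icc m n).filter (fun k : ℕ => 40 * s * ℓ < (k : ℝ)),
      numBoundedParts m n (n - k) : ℕ) : ℝ) ≤ numBoundedParts m n n := by
    have h1 : ∀ k ∈ (Finset.Icc m n).filter (fun k : ℕ => 40 * s * ℓ < (k : ℝ)),
        n ^ 3 * numBoundedParts m n (n - k) ≤ numBoundedParts m n n := by
      intro k hk
      have hk' := (Finset.mem_filter.1 hk).2
      set t := ⌈5 * ℓ⌉₊
      have ht1 : 5 * ℓ ≤ t := Nat.le_ceil _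
      have ht2 : (t : ℝ) < 5 * ℓ + 1 := Nat.ceil_lt_add_one (by linarith)
      have h26 : 26 * R ≤ n := by
        have : 26 * (R : ℝ) ≤ n := by
          have : c₁ * ℓ ≤ 1 / 992 * (2 * s) := by gcongr
          nlinarith
        exact_mod_cast this
      have h2 := two_pow_mul_numBoundedParts_sub_le hm hmR h26 (z := n) (by exact_mod_cast hR2) t
      have h3 : n ^ 3 ≤ 2 ^ t := by
        have : (n : ℝ) ^ 3 ≤ 2 ^ t := by
          rw [← Real.log_le_log_iff (by positivity) (by positivity), Real.log_pow, Real.log_pow]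
          have := Real.log_two_gt_d9
          push_cast
          nlinarith
        exact_mod_cast this
      refine le_trans (Nat.mul_le_mul h3 (numBoundedParts_le_of_sq_le hm hmn ?_)) h2
      have h4 : (t : ℝ) * (26 * R) + m ^ 2 ≤ k := by
        have h5 : (m : ℝ) ^ 2 ≤ R := by exact_mod_cast hmR
        have h6 : (t : ℝ) * (26 * R) ≤ (5 * ℓ + 1) * (26 / 5 * s) :=
          mul_le_mul ht2.le (by linarith) (by positivity) (by linarith)
        nlinarith
      have h5 : t * (26 * R) + m ^ 2 ≤ k := by exact_mod_cast h4
      zify at h5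
      linarith
    have h2 := Finset.sum_le_card_nsmul _ _ _ h1
    rw [← Finset.mul_sum, smul_eq_mul] at h2
    have h3 : ((Finset.Icc m n).filter (fun k : ℕ => 40 * s * ℓ < (k : ℝ))).card ≤ n := by
      refine (Finset.card_filter_le _ _).trans ?_
      rw [Nat.card_Icc]
      omega
    have h4 := h2.trans (Nat.mul_le_mul_right _ h3)
    rw [pow_succ', mul_assoc] at h4
    exact_mod_cast Nat.le_of_mul_le_mul_left h4 (by omega)
  rw [hcard, card_partition_eq_ncard n m hm fun p => (p.sup : ℝ) < c₁ * s * ℓ ∨ 40 * s * ℓ < p.sup]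
  refine ⟨hpos, ?_⟩
  rw [div_mul_eq_mul_div (8 ^ 5 * 33800 ^ 10 + 1 : ℝ), le_div_iff₀' (by positivity)]
  have h1 := ncard_sup_lt_or_lt_sup_le (n := n) hm (x := c₁ * s * ℓ) (y := 40 * s * ℓ)
    (by positivity)
  have h2 : ((n : ℝ) ^ 2) * _ ≤ ((n : ℝ) ^ 2) * _ :=
    mul_le_mul_of_nonneg_left (Nat.cast_le.2 h1) (by positivity)
  refine h2.trans ?_
  rw [Nat.cast_add, mul_add, add_mul, one_mul]
  exact add_le_add hlow hup
end

section
/- Let d ≥ 2 be an integer and let σ ∈ B_d with σ ≠ Id and σ ≠ −Id. Then there exists a real C > 0 (depending only on d) such that for every real x ≥ 16, the number of sublattices L of ℤ^d with index at most x and σ(L) = L is at most C·x^{d−1 + C/log log x}. -/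
/-- `f : ℤ^d → ℤ^d` is a signed permutation (an element of the hyperoctahedral group `B_d`):
`(f x) i = ± x_{τ(i)}` for some permutation `τ` of the coordinates and signs `ε`. -/
def IsSignedPerm (d : ℕ) (f : (Fin d → ℤ) → (Fin d → ℤ)) : Prop :=
  ∃ (τ : Equiv.Perm (Fin d)) (ε : Fin d → ℤ), (∀ i, ε i = 1 ∨ ε i = -1) ∧
    ∀ (x : Fin d → ℤ) (i : Fin d), f x i = ε i * x (τ i)

open scoped ENNReal

/-- The weight `n ↦ n ^ (-s)` truncated to the range `1 ≤ n ≤ X`. -/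
noncomputable def truncWeight (X s n : ℕ) : ℝ≥0∞ :=
  if 1 ≤ n ∧ n ≤ X then ((n : ℝ≥0∞) ^ s)⁻¹ else 0

/-- The harmonic sum `∑_{1 ≤ n ≤ X} 1 / n` as an extended nonnegative real. -/
noncomputable def harmonicSum (X : ℕ) : ℝ≥0∞ := ∑' n, truncWeight X 1 n

lemma truncWeight_zero_right (X s : ℕ) : truncWeight X s 0 = 0 := by simp [truncWeight]

lemma truncWeight_one_le (X s : ℕ) : truncWeight X s 1 ≤ 1 := by
  unfold truncWeight; split_ifs <;> simp

lemma truncWeight_mul_le (X s m n : ℕ) :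
    truncWeight X s (m * n) ≤ truncWeight X s m * truncWeight X s n := by
  by_cases h : 1 ≤ m * n ∧ m * n ≤ X
  · have hm : 1 ≤ m := Nat.pos_of_mul_pos_right h.1
    have hn : 1 ≤ n := Nat.pos_of_mul_pos_left h.1
    have hm' : m ≤ X := le_trans (Nat.le_mul_of_pos_right m hn) h.2
    have hn' : n ≤ X := le_trans (Nat.le_mul_of_pos_left n hm) h.2
    have e : ((m : ℝ≥0∞)^s * (n : ℝ≥0∞)^s)⁻¹ = ((m : ℝ≥0∞)^s)⁻¹ * ((n : ℝ≥0∞)^s)⁻¹ :=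
      ENNReal.mul_inv (Or.inl (pow_ne_zero _ (by simpa using Nat.one_le_iff_ne_zero.mp hm)))
        (Or.inl (ENNReal.pow_ne_top (by simp)))
    simp only [truncWeight, h, hm, hm', hn, hn', and_self, if_true, Nat.cast_mul, mul_pow, e, le_refl]
  · simp [truncWeight, h]

lemma truncWeight_anti (X n : ℕ) {s t : ℕ} (h : s ≤ t) :
    truncWeight X t n ≤ truncWeight X s n := by
  unfold truncWeight
  split_ifs with hn
  · exact ENNReal.inv_le_inv.mpr (pow_le_pow_right₀ (by exact_mod_cast hn.1) h)
  · exact le_rfl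

lemma pow_mul_truncWeight_le (X n : ℕ) {r s t : ℕ} (h : r + s ≤ t) :
    (n : ℝ≥0∞) ^ r * truncWeight X t n ≤ truncWeight X s n := by
  refine (mul_le_mul_right (truncWeight_anti X n h) _).trans ?_
  unfold truncWeight
  split_ifs with hn
  · have h0 : (n : ℝ≥0∞) ≠ 0 := by simpa using Nat.one_le_iff_ne_zero.mp hn.1
    rw [pow_add, ENNReal.mul_inv (Or.inl (pow_ne_zero _ h0))
      (Or.inl (ENNReal.pow_ne_top (by simp))), ← mul_assoc,
      ENNReal.mul_inv_cancel (pow_ne_zero _ h0) (ENNReal.pow_ne_top (by simp)), one_mul]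
  · simp

section Exact

variable {W M Q : Type*} [AddCommGroup W] [AddCommGroup M] [AddCommGroup Q]

lemma AddSubgroup.index_eq_mul_of_exact {ι : W →+ M} {π : M →+ Q}
    (hπ : Function.Surjective π) (hex : ι.range = π.ker) (L : AddSubgroup M) :
    L.index = (L.comap ι).index * (L.map π).index := by
  have h1 : π.range = ⊤ := AddMonoidHom.range_eq_top.mpr hπ
  rw [AddSubgroup.index_map, AddSubgroup.index_comap, hex, h1, AddSubgroup.index_top, mul_one,
    ← AddSubgroup.relIndex_mul_index (le_sup_left : L ≤ L ⊔ π.ker),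
    AddSubgroup.relIndex_sup_left]

lemma AddSubgroup.le_of_exact {ι : W →+ M} {π : M →+ Q} (hex : ι.range = π.ker)
    {L K : AddSubgroup M} (h1 : L.comap ι ≤ K.comap ι) {α : Type*} (g : α → Q)
    (h2 : L.map π = AddSubgroup.closure (Set.range g))
    (h3 : ∀ j, ∃ v ∈ L, v ∈ K ∧ π v = g j) : L ≤ K := by
  have h4 : L.map π ≤ (L ⊓ K).map π := by
    rw [h2, AddSubgroup.closure_le]
    rintro _ ⟨j, rfl⟩
    obtain ⟨v, hv, hv', e⟩ := h3 j
    exact ⟨v, ⟨hv, hv'⟩, e⟩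
  intro v hv
  obtain ⟨u, ⟨hu, hu'⟩, e⟩ := h4 ⟨v, hv, rfl⟩
  have hker : v - u ∈ π.ker := by simp [AddMonoidHom.mem_ker, e]
  rw [← hex] at hker
  obtain ⟨w, hw⟩ := hker
  have : w ∈ L.comap ι := by
    rw [AddSubgroup.mem_comap, hw]; exact L.sub_mem hv hu
  have := h1 this
  rw [AddSubgroup.mem_comap, hw] at this
  simpa using K.add_mem this hu'

lemma AddSubgroup.eq_of_exact {ι : W →+ M} {π : M →+ Q} (hex : ι.range = π.ker)
    {L K : AddSubgroup M} (h1 : L.comap ι = K.comap ι) {α : Type*} (g : α → Q)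
    (h2 : L.map π = AddSubgroup.closure (Set.range g))
    (h2' : K.map π = AddSubgroup.closure (Set.range g))
    (h3 : ∀ j, ∃ v ∈ L, v ∈ K ∧ π v = g j) : L = K :=
  le_antisymm (le_of_exact hex h1.le g h2 h3)
    (le_of_exact hex h1.ge g h2' fun j => by
      obtain ⟨v, hv, hv', e⟩ := h3 j
      exact ⟨v, hv', hv, e⟩)

/-- Summing over subgroups `L` of the middle term of a short exact sequence, when `L` is determined
by its trace `L₁` on the kernel, its image `L'`, and one coset of `L₁` for each of `r` generators
of `L'`. -/
lemma tsum_truncWeight_index_le_of_exact {ι : W →+ M} {π : M →+ Q}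
    (hπ : Function.Surjective π) (hex : ι.range = π.ker)
    (P : AddSubgroup M → Prop) (P₁ : AddSubgroup W → Prop) (hP : ∀ L, P L → P₁ (L.comap ι))
    (r X s : ℕ)
    (hgen : ∀ L' : AddSubgroup Q, ∃ g : Fin r → Q, AddSubgroup.closure (Set.range g) = L') :
    ∑' L : {L // P L}, truncWeight X s L.1.index ≤
      (∑' L : {L // P₁ L}, (L.1.index : ℝ≥0∞) ^ r * truncWeight X s L.1.index) *
        ∑' L : AddSubgroup Q, truncWeight X s L.index := by
  choose gen hgen using hgen
  have key : ∀ (L : AddSubgroup M) (j : Fin r), ∃ w : W,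
      Function.surjInv hπ (gen (L.map π) j) + ι w ∈ L := by
    intro L j
    have hm : gen (L.map π) j ∈ L.map π :=
      (hgen (L.map π)).le (AddSubgroup.subset_closure (Set.mem_range_self j))
    obtain ⟨v, hv, e⟩ := hm
    have hker : v - Function.surjInv hπ (gen (L.map π) j) ∈ π.ker := by
      rw [AddMonoidHom.mem_ker, map_sub, Function.surjInv_eq hπ, e, sub_self]
    rw [← hex] at hker
    obtain ⟨w, hw⟩ := hker
    exact ⟨w, by rw [hw]; simpa using hv⟩
  choose c hc using key
  let F : {L // P L} → Σ p : {L // P₁ L} × AddSubgroup Q, (Fin r → W ⧸ p.1.1) := fun L =>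
    ⟨(⟨L.1.comap ι, hP _ L.2⟩, L.1.map π), fun j => (c L.1 j : W ⧸ L.1.comap ι)⟩
  have hF : Function.Injective F := by
    intro L K h
    have h' := h
    simp only [F, Sigma.mk.injEq, Prod.mk.injEq, Subtype.mk.injEq] at h'
    obtain ⟨⟨h1, h2⟩, -⟩ := h'
    have h3 : ∀ j, c K.1 j - c L.1 j ∈ L.1.comap ι := by
      have aux : ∀ (A B : Σ p : {L // P₁ L} × AddSubgroup Q, (Fin r → W ⧸ p.1.1)), A = B →
          ∀ (a b : Fin r → W), (A.2 = fun j => (a j : W ⧸ A.1.1.1)) →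
          (B.2 = fun j => (b j : W ⧸ B.1.1.1)) → ∀ j, b j - a j ∈ A.1.1.1 := by
        rintro A _ rfl a b ha hb j
        have := congrFun (ha.symm.trans hb) j
        rw [QuotientAddGroup.eq] at this
        rwa [sub_eq_neg_add]
      exact aux _ _ h _ _ rfl rfl
    refine Subtype.ext (AddSubgroup.eq_of_exact hex h1 (gen (L.1.map π)) (hgen _).symm
      (by rw [hgen, h2]) fun j => ?_)
    refine ⟨_, hc L.1 j, ?_, ?_⟩
    · have h4 := hc K.1 j
      have h5 := h3 j
      rw [h1, AddSubgroup.mem_comap] at h5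
      rw [← h2] at h4
      convert K.1.sub_mem h4 h5 using 1
      rw [map_sub]; abel
    · have : ι (c L.1 j) ∈ π.ker := by rw [← hex]; exact ⟨_, rfl⟩
      rw [map_add, AddMonoidHom.mem_ker.mp this, add_zero, Function.surjInv_eq hπ]
  calc ∑' L : {L // P L}, truncWeight X s L.1.index
      ≤ ∑' L : {L // P L}, truncWeight X s (F L).1.1.1.index * truncWeight X s (F L).1.2.index := by
        refine ENNReal.tsum_le_tsum fun L => ?_
        rw [AddSubgroup.index_eq_mul_of_exact hπ hex]
        exact truncWeight_mul_le _ _ _ _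
    _ ≤ ∑' A : Σ p : {L // P₁ L} × AddSubgroup Q, (Fin r → W ⧸ p.1.1),
          truncWeight X s A.1.1.1.index * truncWeight X s A.1.2.index :=
        ENNReal.tsum_comp_le_tsum_of_injective hF
          (fun A => truncWeight X s A.1.1.1.index * truncWeight X s A.1.2.index)
    _ = ∑' p : {L // P₁ L} × AddSubgroup Q, ∑' _ : (Fin r → W ⧸ p.1.1),
          truncWeight X s p.1.1.index * truncWeight X s p.2.index :=
        ENNReal.tsum_sigma (fun (p : {L // P₁ L} × AddSubgroup Q) (_ : Fin r → W ⧸ p.1.1) =>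
          truncWeight X s p.1.1.index * truncWeight X s p.2.index)
    _ ≤ ∑' p : {L // P₁ L} × AddSubgroup Q,
          ((p.1.1.index : ℝ≥0∞) ^ r * truncWeight X s p.1.1.index) *
            truncWeight X s p.2.index := by
        refine ENNReal.tsum_le_tsum fun p => ?_
        rw [ENNReal.tsum_const, ← mul_assoc]
        by_cases h0 : p.1.1.index = 0
        · simp [h0, truncWeight_zero_right]
        · have : p.1.1.FiniteIndex := ⟨h0⟩
          rw [ENat.card_eq_coe_natCard, Nat.card_fun, Nat.card_eq_fintype_card (α := Fin r),
            Fintype.card_fin]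
          simp [AddSubgroup.index, mul_assoc]
    _ = _ := by
        rw [ENNReal.tsum_prod (f := fun (L : {L // P₁ L}) (L' : AddSubgroup Q) =>
          ((L.1.index : ℝ≥0∞) ^ r * truncWeight X s L.1.index) * truncWeight X s L'.index),
          ← ENNReal.tsum_mul_right]
        simp only [ENNReal.tsum_mul_left]

end Exact

lemma AddSubgroup.exists_fin_generators {Q : Type*} [AddCommGroup Q] [Module.Free ℤ Q]
    [Module.Finite ℤ Q] {r : ℕ} (hr : Module.finrank ℤ Q ≤ r) (L : AddSubgroup Q) :
    ∃ g : Fin r → Q, AddSubgroup.closure (Set.range g) = L ∧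
      ∀ v ∈ L, ∃ z : Fin r → ℤ, ∑ i, z i • g i = v := by
  obtain ⟨n, ⟨b⟩⟩ := Submodule.nonempty_basis_of_pid (Module.finBasis ℤ Q) L.toIntSubmodule
  have hn : n ≤ r := by
    have h1 := Module.finrank_eq_card_basis b
    have h2 := Submodule.finrank_le L.toIntSubmodule
    rw [Fintype.card_fin] at h1
    omega
  set g : Fin r → Q := fun j => if h : j.1 < n then (b ⟨j, h⟩ : Q) else 0 with hg
  have hgL : ∀ j, g j ∈ L := by
    intro j
    simp only [hg]
    split_ifs with h
    · exact (b ⟨j, h⟩).2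
    · exact L.zero_mem
  have hsum : ∀ v ∈ L, ∃ z : Fin r → ℤ, ∑ i, z i • g i = v := by
    intro v hv
    refine ⟨fun j => if h : j.1 < n then b.repr ⟨v, hv⟩ ⟨j, h⟩ else 0, ?_⟩
    have h := congrArg Subtype.val (b.sum_repr (⟨v, hv⟩ : L.toIntSubmodule))
    rw [AddSubmonoidClass.coe_finsetSum] at h
    refine Eq.trans (Eq.symm ?_) h
    refine (Finset.sum_of_injOn (Fin.castLE hn) (Fin.castLE_injective hn).injOn
      (fun _ _ => Finset.mem_coe.mpr (Finset.mem_univ _)) (fun j _ hj => ?_) fun i _ => ?_)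
    · have : ¬ j.1 < n := fun h => hj ⟨⟨j, h⟩, by simp, by ext; simp⟩
      simp [this]
    · simp [hg]
  refine ⟨g, le_antisymm ?_ fun v hv => ?_, hsum⟩
  · rw [AddSubgroup.closure_le]
    rintro _ ⟨j, rfl⟩
    exact hgL j
  · obtain ⟨z, rfl⟩ := hsum v hv
    exact AddSubgroup.sum_mem _ fun i _ => AddSubgroup.zsmul_mem _
      (AddSubgroup.subset_closure (Set.mem_range_self i)) _

lemma AddSubgroup.exists_closure_range_eq {Q : Type*} [AddCommGroup Q] [Module.Free ℤ Q]
    [Module.Finite ℤ Q] {r : ℕ} (hr : Module.finrank ℤ Q ≤ r) (L : AddSubgroup Q) :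
    ∃ g : Fin r → Q, AddSubgroup.closure (Set.range g) = L :=
  (L.exists_fin_generators hr).imp fun _ h => h.1

lemma tsum_truncWeight_index_equiv_le {M N : Type*} [AddCommGroup M] [AddCommGroup N] (e : M ≃+ N)
    (X s : ℕ) : ∑' L : AddSubgroup M, truncWeight X s L.index ≤
      ∑' L : AddSubgroup N, truncWeight X s L.index := by
  have hinj : Function.Injective fun L : AddSubgroup M => L.comap e.symm.toAddMonoidHom :=
    AddSubgroup.comap_injective e.symm.surjective
  refine le_trans (le_of_eq ?_) (ENNReal.tsum_comp_le_tsum_of_injective hinj _)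
  congr 1; ext L
  rw [AddSubgroup.index_comap_of_surjective _ e.symm.surjective]

lemma AddSubgroup.index_injective_int : Function.Injective (AddSubgroup.index : AddSubgroup ℤ → ℕ) := by
  intro A B h
  obtain ⟨a, rfl⟩ := Int.subgroup_cyclic A
  obtain ⟨b, rfl⟩ := Int.subgroup_cyclic B
  rw [← AddSubgroup.zmultiples_eq_closure, ← AddSubgroup.zmultiples_eq_closure] at h ⊢
  rw [Int.index_zmultiples, Int.index_zmultiples] at h
  rw [← Int.zmultiples_natAbs a, h, Int.zmultiples_natAbs]

lemma tsum_truncWeight_index_pi_le (X w s : ℕ) (h : w ≤ s) :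
    ∑' L : AddSubgroup (Fin w → ℤ), truncWeight X s L.index ≤ harmonicSum X ^ w := by
  induction w with
  | zero =>
    rw [tsum_eq_single ⊤ fun L hL => absurd (Subsingleton.elim L ⊤) hL, AddSubgroup.index_top]
    simpa using truncWeight_one_le X s
  | succ w ih =>
    let ι : ℤ →+ (Fin (w + 1) → ℤ) := AddMonoidHom.single (fun _ => ℤ) 0
    let π : (Fin (w + 1) → ℤ) →+ (Fin w → ℤ) :=
      { toFun := fun v i => v i.succ
        map_zero' := rfl
        map_add' := fun _ _ => rfl }
    have hπ : Function.Surjective π := fun v => ⟨Fin.cons 0 v, by ext i; simp [π]⟩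
    have hex : ι.range = π.ker := by
      ext v
      rw [AddMonoidHom.mem_ker]
      constructor
      · rintro ⟨z, rfl⟩
        ext i
        simp [π, ι]
      · intro hv
        refine ⟨v 0, ?_⟩
        ext i
        refine Fin.cases ?_ (fun j => ?_) i
        · simp [ι]
        · simpa [ι, π] using (congrFun hv j).symm
    have h1 := tsum_truncWeight_index_le_of_exact hπ hex (fun _ => True) (fun _ => True)
      (fun _ _ => trivial) w X s (AddSubgroup.exists_closure_range_eq (by simp))
    have h2 : ∑' L : {L : AddSubgroup ℤ // True},
        (L.1.index : ℝ≥0∞) ^ w * truncWeight X s L.1.index ≤ harmonicSum X :=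
      calc _ ≤ ∑' L : {L : AddSubgroup ℤ // True}, truncWeight X 1 L.1.index :=
            ENNReal.tsum_le_tsum fun L => pow_mul_truncWeight_le X _ h
        _ ≤ harmonicSum X := ENNReal.tsum_comp_le_tsum_of_injective
            (AddSubgroup.index_injective_int.comp Subtype.val_injective) (truncWeight X 1)
    have h3 : ∑' L : AddSubgroup (Fin (w + 1) → ℤ), truncWeight X s L.index =
        ∑' L : {L : AddSubgroup (Fin (w + 1) → ℤ) // True}, truncWeight X s L.1.index :=
      ((Equiv.subtypeUnivEquiv fun _ => trivial).tsum_eq fun L : AddSubgroup (Fin (w + 1) → ℤ) =>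
        truncWeight X s L.index).symm
    rw [h3, pow_succ']
    exact h1.trans (mul_le_mul' h2 (ih (by omega)))

lemma tsum_truncWeight_index_le {M : Type*} [AddCommGroup M] [Module.Free ℤ M] [Module.Finite ℤ M]
    (X s : ℕ) (h : Module.finrank ℤ M ≤ s) :
    ∑' L : AddSubgroup M, truncWeight X s L.index ≤ harmonicSum X ^ Module.finrank ℤ M :=
  (tsum_truncWeight_index_equiv_le (Module.finBasis ℤ M).equivFun.toAddEquiv X s).trans
    (tsum_truncWeight_index_pi_le X _ s h)

/-- Subgroups stable under a nontrivial endomorphism of finite order with a nonzero fixed vector. -/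
lemma tsum_truncWeight_index_stable_le_of_fixed {M : Type*} [AddCommGroup M] [Module.Free ℤ M]
    [Module.Finite ℤ M] (S : AddMonoid.End M) {m : ℕ} (hm : 0 < m) (hS : S ^ m = 1) (hS1 : S ≠ 1)
    {u : M} (hu : u ≠ 0) (hSu : S u = u) (X s : ℕ) (hs : Module.finrank ℤ M ≤ s + 1) :
    ∑' L : {L : AddSubgroup M // ∀ v ∈ L, S v ∈ L}, truncWeight X s L.1.index ≤
      ((m ^ (Module.finrank ℤ M * Module.finrank ℤ M) : ℕ) : ℝ≥0∞) *
        harmonicSum X ^ Module.finrank ℤ M := by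
  have : NeZero m := ⟨hm.ne'⟩
  set d := Module.finrank ℤ M with hd
  let f : M →ₗ[ℤ] M := AddMonoidHom.toIntLinearMap (S - 1 : AddMonoid.End M)
  have hf : ∀ v, f v = S v - v := fun v => rfl
  let N : AddMonoid.End M := ∑ i ∈ Finset.range m, S ^ i
  let ι : LinearMap.ker f →+ M := (LinearMap.ker f).subtype.toAddMonoidHom
  let π : M →+ LinearMap.range f := f.rangeRestrict.toAddMonoidHom
  have hπ : Function.Surjective π := LinearMap.surjective_rangeRestrict f
  have hπv : ∀ v, (π v : M) = S v - v := fun v => rfl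
  have hex : ι.range = π.ker := by
    ext v
    rw [AddMonoidHom.mem_ker, ← Subtype.coe_inj, hπv]
    constructor
    · rintro ⟨w, rfl⟩
      exact w.2
    · intro hv
      exact ⟨⟨v, hv⟩, rfl⟩
  have hrank : Module.finrank ℤ (LinearMap.range f) + Module.finrank ℤ (LinearMap.ker f) = d := by
    rw [← f.quotKerEquivRange.finrank_eq, Submodule.finrank_quotient_add_finrank]
  have hker : 0 < Module.finrank ℤ (LinearMap.ker f) := by
    have : Nontrivial (LinearMap.ker f) :=
      ⟨⟨⟨u, by rw [LinearMap.mem_ker, hf, hSu, sub_self]⟩, 0, fun h => hu (congrArg Subtype.val h)⟩⟩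
    exact Module.finrank_pos
  have hrange : 0 < Module.finrank ℤ (LinearMap.range f) := by
    have : ∃ v, S v ≠ v := by
      by_contra! h
      exact hS1 (AddMonoidHom.ext h)
    obtain ⟨v, hv⟩ := this
    have : Nontrivial (LinearMap.range f) :=
      ⟨⟨⟨f v, v, rfl⟩, 0, fun h => hv (sub_eq_zero.mp (congrArg Subtype.val h))⟩⟩
    exact Module.finrank_pos
  have hNW : ∀ v, S (N v) = N v := fun v => by
    have h : (S - 1) * N = 0 := by rw [mul_geom_sum, hS, sub_self]
    exact sub_eq_zero.mp (DFunLike.congr_fun h v)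
  have hNfix : ∀ w, S w = w → N w = m • w := fun w hw => by
    have h : ∀ i, (S ^ i) w = w := fun i => by
      induction i with
      | zero => rfl
      | succ i ih => rw [pow_succ]; exact (congrArg (S ^ i) hw).trans ih
    calc N w = ∑ i ∈ Finset.range m, (S ^ i) w := AddMonoidHom.finsetSum_apply _ _ _
      _ = m • w := by simp [h]
  have hNL : ∀ L : AddSubgroup M, (∀ v ∈ L, S v ∈ L) → ∀ v ∈ L, N v ∈ L := fun L hL v hv => by
    have h : ∀ i, (S ^ i) v ∈ L := fun i => by
      induction i with
      | zero => exact hv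
      | succ i ih => rw [pow_succ']; exact hL _ ih
    rw [show N v = ∑ i ∈ Finset.range m, (S ^ i) v from AddMonoidHom.finsetSum_apply _ _ _]
    exact L.sum_mem fun i _ => h i
  choose gQ hgQ using fun L : AddSubgroup (LinearMap.range f) =>
    L.exists_closure_range_eq (r := d) (by omega)
  choose gW hgW' hgW using fun L : AddSubgroup (LinearMap.ker f) =>
    L.exists_fin_generators (r := d) (by omega)
  have hlift : ∀ (L : AddSubgroup M) (j : Fin d), ∃ v ∈ L, π v = gQ (L.map π) j := fun L j => by
    have hmem : gQ (L.map π) j ∈ L.map π :=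
      (hgQ (L.map π)).le (AddSubgroup.subset_closure (Set.mem_range_self j))
    exact hmem
  choose v hvL hvπ using hlift
  have hz : ∀ (L : {L : AddSubgroup M // ∀ v ∈ L, S v ∈ L}) (j : Fin d), ∃ z : Fin d → ℤ,
      N (v L.1 j) = ι (∑ i, z i • gW (L.1.comap ι) i) := fun L j => by
    obtain ⟨z, hz⟩ := hgW (L.1.comap ι)
      ⟨N (v L.1 j), by rw [LinearMap.mem_ker, hf, hNW, sub_self]⟩ (hNL _ L.2 _ (hvL _ _))
    exact ⟨z, by rw [hz]; rfl⟩
  choose z hz using hz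
  let F : {L : AddSubgroup M // ∀ v ∈ L, S v ∈ L} →
      (AddSubgroup (LinearMap.ker f) × AddSubgroup (LinearMap.range f)) ×
        (Fin d → Fin d → ZMod m) :=
    fun L => ((L.1.comap ι, L.1.map π), fun j i => (z L j i : ZMod m))
  have hF : Function.Injective F := by
    intro L K h
    simp only [F, Prod.mk.injEq] at h
    obtain ⟨⟨h1, h2⟩, h3⟩ := h
    refine Subtype.ext (AddSubgroup.eq_of_exact hex h1 (gQ (L.1.map π)) (hgQ _).symm
      (by rw [hgQ, h2]) fun j => ⟨v L.1 j, hvL _ _, ?_, hvπ _ _⟩)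
    have h4 : ∀ i, ∃ y, z L j i - z K j i = m * y := fun i => by
      have h5 := congrFun (congrFun h3 j) i
      have h5' := (ZMod.intCast_eq_intCast_iff_dvd_sub _ _ _).mp h5.symm
      exact h5'
    choose y hy using h4
    have hgL : ∀ i, gW (L.1.comap ι) i ∈ L.1.comap ι := fun i =>
      (hgW' (L.1.comap ι)).le (AddSubgroup.subset_closure (Set.mem_range_self i))
    set x := ι (∑ i, y i • gW (L.1.comap ι) i) with hx
    have hxL : x ∈ K.1 := by
      have : ∑ i, y i • gW (L.1.comap ι) i ∈ K.1.comap ι :=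
        h1 ▸ AddSubgroup.sum_mem _ fun i _ => AddSubgroup.zsmul_mem _ (hgL i) _
      exact this
    have hdiff : S (v L.1 j - v K.1 j) = v L.1 j - v K.1 j := by
      have h5 : π (v L.1 j) = π (v K.1 j) := by rw [hvπ, hvπ, h2]
      have h6 := congrArg Subtype.val h5
      rw [hπv, hπv] at h6
      rw [map_sub, sub_eq_sub_iff_sub_eq_sub, h6]
    have hmul : m • (v L.1 j - v K.1 j) = m • x := by
      rw [← hNfix _ hdiff, map_sub, hz, hz, hx, ← map_sub, ← h1, ← Finset.sum_sub_distrib,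
        ← map_nsmul, Finset.smul_sum]
      congr 1
      refine Finset.sum_congr rfl fun i _ => ?_
      rw [← sub_smul, hy, mul_smul, natCast_zsmul]
    have hxv : v L.1 j - v K.1 j = x := by
      rw [← natCast_zsmul, ← natCast_zsmul] at hmul
      exact smul_right_injective M (Int.natCast_ne_zero.mpr hm.ne') hmul
    rw [← hxv] at hxL
    simpa using K.1.add_mem hxL (hvL K.1 j)
  calc ∑' L : {L : AddSubgroup M // ∀ v ∈ L, S v ∈ L}, truncWeight X s L.1.index
      ≤ ∑' L : {L : AddSubgroup M // ∀ v ∈ L, S v ∈ L},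
          truncWeight X s (F L).1.1.index * truncWeight X s (F L).1.2.index := by
        refine ENNReal.tsum_le_tsum fun L => ?_
        rw [AddSubgroup.index_eq_mul_of_exact hπ hex]
        exact truncWeight_mul_le _ _ _ _
    _ ≤ ∑' A : (AddSubgroup (LinearMap.ker f) × AddSubgroup (LinearMap.range f)) ×
          (Fin d → Fin d → ZMod m), truncWeight X s A.1.1.index * truncWeight X s A.1.2.index :=
        ENNReal.tsum_comp_le_tsum_of_injective hF
          (fun A => truncWeight X s A.1.1.index * truncWeight X s A.1.2.index)
    _ = ((m ^ (d * d) : ℕ) : ℝ≥0∞) *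
          ((∑' L : AddSubgroup (LinearMap.ker f), truncWeight X s L.index) *
            ∑' L : AddSubgroup (LinearMap.range f), truncWeight X s L.index) := by
        rw [ENNReal.tsum_prod (f := fun (p : AddSubgroup (LinearMap.ker f) ×
          AddSubgroup (LinearMap.range f)) (_ : Fin d → Fin d → ZMod m) =>
            truncWeight X s p.1.index * truncWeight X s p.2.index)]
        have hcard : (ENat.card (Fin d → Fin d → ZMod m) : ℝ≥0∞) = ((m ^ (d * d) : ℕ) : ℝ≥0∞) := by
          rw [ENat.card_eq_coe_natCard, Nat.card_fun, Nat.card_fun, Nat.card_zmod, Nat.card_fin,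
            ← pow_mul]
          rfl
        simp only [ENNReal.tsum_const, hcard, ENNReal.tsum_mul_left]
        rw [ENNReal.tsum_prod (f := fun (L : AddSubgroup (LinearMap.ker f))
          (L' : AddSubgroup (LinearMap.range f)) =>
            truncWeight X s L.index * truncWeight X s L'.index)]
        simp only [ENNReal.tsum_mul_left, ENNReal.tsum_mul_right]
    _ ≤ ((m ^ (d * d) : ℕ) : ℝ≥0∞) * (harmonicSum X ^ Module.finrank ℤ (LinearMap.ker f) *
          harmonicSum X ^ Module.finrank ℤ (LinearMap.range f)) := by
        gcongr
        · exact tsum_truncWeight_index_le X s (by omega)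
        · exact tsum_truncWeight_index_le X s (by omega)
    _ = _ := by rw [← pow_add, add_comm, hrank]

lemma truncWeight_le_of_le (X s : ℕ) {m n : ℕ} (hm : 1 ≤ m) (h : m ≤ n) :
    truncWeight X s n ≤ truncWeight X s m := by
  by_cases hn : 1 ≤ n ∧ n ≤ X
  · simp only [truncWeight, hn, hm, h.trans hn.2, and_self, if_true]
    gcongr
  · simp [truncWeight, hn]

lemma tsum_truncWeight_max_natAbs_le (X : ℕ) :
    ∑' a : ℤ, truncWeight X 1 (max a.natAbs 1) ≤ 2 * (1 + harmonicSum X) := by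
  have hinj : Function.Injective fun a : ℤ => (a.natAbs, decide (a < 0)) := by
    intro a b h
    simp only [Prod.mk.injEq, decide_eq_decide] at h
    omega
  calc ∑' a : ℤ, truncWeight X 1 (max a.natAbs 1)
      ≤ ∑' p : ℕ × Bool, truncWeight X 1 (max p.1 1) :=
        ENNReal.tsum_comp_le_tsum_of_injective hinj fun p => truncWeight X 1 (max p.1 1)
    _ = ∑' n : ℕ, 2 * truncWeight X 1 (max n 1) := by
        rw [ENNReal.tsum_prod (f := fun n (_ : Bool) => truncWeight X 1 (max n 1))]
        simp [two_mul]
    _ ≤ ∑' n : ℕ, 2 * ((if n = 0 then 1 else 0) + truncWeight X 1 n) := by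
        refine ENNReal.tsum_le_tsum fun n => mul_le_mul_right ?_ 2
        rcases Nat.eq_zero_or_pos n with rfl | hn
        · simpa using (truncWeight_one_le X 1).trans le_self_add
        · rw [max_eq_left hn]
          exact le_add_self
    _ = 2 * (1 + harmonicSum X) := by
        rw [ENNReal.tsum_mul_left, ENNReal.tsum_add, tsum_ite_eq, harmonicSum]

lemma GaussianInt.index_eq_of_forall_mem_iff {A : AddSubgroup GaussianInt} {z : GaussianInt}
    (hz : z ≠ 0) (hA : ∀ w, w ∈ A ↔ z ∣ w) :
    A.index = z.re.natAbs * z.re.natAbs + z.im.natAbs * z.im.natAbs := by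
  let e₀ : GaussianInt ≃ₗ[ℤ] (Fin 2 → ℤ) :=
    { toFun := fun w => ![w.re, w.im]
      invFun := fun v => ⟨v 0, v 1⟩
      left_inv := fun w => rfl
      right_inv := fun v => by ext i; fin_cases i <;> rfl
      map_add' := fun v w => by ext i; fin_cases i <;> rfl
      map_smul' := fun c w => by ext i; fin_cases i <;> simp }
  let B : Module.Basis (Fin 2) ℤ GaussianInt := Module.Basis.ofEquivFun e₀
  have : Module.Free ℤ GaussianInt := .of_basis B
  have : Module.Finite ℤ GaussianInt := .of_basis B
  let e : GaussianInt ≃+ A.toIntSubmodule :=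
    AddEquiv.ofBijective
      ((AddMonoidHom.mulLeft z).codRestrict A.toIntSubmodule fun w => (hA _).mpr ⟨w, rfl⟩)
      ⟨fun v w h => mul_left_cancel₀ hz (congrArg Subtype.val h), fun w => by
        obtain ⟨v, hv⟩ := (hA _).mp w.2
        exact ⟨v, Subtype.ext hv.symm⟩⟩
  have h := Submodule.natAbs_det_equiv A.toIntSubmodule e
  rw [← LinearMap.det_toMatrix B, Matrix.det_fin_two] at h
  have hcard : Nat.card (GaussianInt ⧸ A.toIntSubmodule) = A.index := rfl
  have hB : ∀ i, B i = ⟨if i = 0 then 1 else 0, if i = 1 then 1 else 0⟩ := fun i => by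
    rw [Module.Basis.coe_ofEquivFun]
    fin_cases i <;> rfl
  have hrep : ∀ w i, B.repr w i = ![w.re, w.im] i := fun w i => rfl
  have he : ∀ w, ((e w : GaussianInt)) = z * w := fun w => rfl
  rw [hcard] at h
  rw [← h]
  simp [LinearMap.toMatrix_apply, hrep, hB, he]
  rw [Int.natAbs_add_of_nonneg (mul_self_nonneg _) (mul_self_nonneg _), Int.natAbs_mul,
    Int.natAbs_mul]

lemma tsum_truncWeight_index_gaussianInt_le (X : ℕ) :
    ∑' A : {A : AddSubgroup GaussianInt // ∀ z ∈ A, (⟨0, 1⟩ : GaussianInt) * z ∈ A},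
      truncWeight X 1 A.1.index ≤ (2 * (1 + harmonicSum X)) ^ 2 := by
  have hgen : ∀ A : {A : AddSubgroup GaussianInt // ∀ z ∈ A, (⟨0, 1⟩ : GaussianInt) * z ∈ A},
      ∃ z, ∀ w, w ∈ A.1 ↔ z ∣ w := by
    intro A
    let J : Ideal GaussianInt :=
      { A.1 with
        smul_mem' := fun c x hx => by
          have h : c • x = c.re • x + c.im • ((⟨0, 1⟩ : GaussianInt) * x) := by
            ext <;> simp
          rw [h]
          exact A.1.add_mem (A.1.zsmul_mem hx _) (A.1.zsmul_mem (A.2 x hx) _) }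
    obtain ⟨z, hz⟩ := (IsPrincipalIdealRing.principal J).principal
    refine ⟨z, fun w => ?_⟩
    rw [← Ideal.mem_span_singleton, ← Ideal.submodule_span_eq, ← hz]
    rfl
  choose g hg using hgen
  have hinj : Function.Injective fun A => ((g A).re, (g A).im) := by
    intro A B h
    have h' : g A = g B := by
      simp only [Prod.mk.injEq] at h
      exact Zsqrtd.ext h.1 h.2
    ext w
    rw [hg, hg, h']
  calc _ ≤ ∑' A : {A : AddSubgroup GaussianInt // ∀ z ∈ A, (⟨0, 1⟩ : GaussianInt) * z ∈ A},
        truncWeight X 1 (max (g A).re.natAbs 1) * truncWeight X 1 (max (g A).im.natAbs 1) := by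
        refine ENNReal.tsum_le_tsum fun A => ?_
        by_cases hz : g A = 0
        · have hbot : A.1 = ⊥ := by
            ext w
            rw [hg, hz, zero_dvd_iff, AddSubgroup.mem_bot]
          have : Infinite GaussianInt :=
            Infinite.of_injective (fun n : ℤ => (n : GaussianInt)) Int.cast_injective
          rw [hbot, AddSubgroup.index_bot, Nat.card_eq_zero_of_infinite, truncWeight_zero_right]
          exact zero_le
        · rw [GaussianInt.index_eq_of_forall_mem_iff hz (hg A)]
          refine (truncWeight_le_of_le X 1 (m := max (g A).re.natAbs 1 * max (g A).im.natAbs 1)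
            (Nat.mul_pos (by simp) (by simp)) ?_).trans (truncWeight_mul_le _ _ _ _)
          have hne : (g A).re.natAbs ≠ 0 ∨ (g A).im.natAbs ≠ 0 := by
            by_contra! h
            exact hz (Zsqrtd.ext (Int.natAbs_eq_zero.mp h.1) (Int.natAbs_eq_zero.mp h.2))
          generalize (g A).re.natAbs = x at hne
          generalize (g A).im.natAbs = y at hne
          rcases Nat.eq_zero_or_pos x with rfl | hx <;> rcases Nat.eq_zero_or_pos y with rfl | hy
          · simp at hne
          · simp only [zero_le, max_eq_right, max_eq_left (Nat.succ_le_of_lt hy)]; nlinarith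
          · simp only [zero_le, max_eq_right, max_eq_left (Nat.succ_le_of_lt hx)]; nlinarith
          · rw [max_eq_left hx, max_eq_left (Nat.succ_le_of_lt hy)]; nlinarith [sq_nonneg ((x : ℤ) - y)]
    _ ≤ ∑' p : ℤ × ℤ, truncWeight X 1 (max p.1.natAbs 1) * truncWeight X 1 (max p.2.natAbs 1) :=
        ENNReal.tsum_comp_le_tsum_of_injective hinj fun p : ℤ × ℤ =>
          truncWeight X 1 (max p.1.natAbs 1) * truncWeight X 1 (max p.2.natAbs 1)
    _ = (∑' a : ℤ, truncWeight X 1 (max a.natAbs 1)) ^ 2 := by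
        rw [ENNReal.tsum_prod (f := fun a b : ℤ =>
          truncWeight X 1 (max a.natAbs 1) * truncWeight X 1 (max b.natAbs 1))]
        simp only [ENNReal.tsum_mul_left, ENNReal.tsum_mul_right, sq]
    _ ≤ _ := by gcongr; exact tsum_truncWeight_max_natAbs_le X

/-- Subgroups of `ℤ^d` stable under an endomorphism that acts on a coordinate plane as a rotation
by a right angle. -/
lemma tsum_truncWeight_index_stable_le_of_rotation {d : ℕ} (S : (Fin d → ℤ) →+ (Fin d → ℤ))
    {a b : Fin d} (hab : a ≠ b) {δ : ℤ} (hδ : δ * δ = 1)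
    (hSa : S (Pi.single a 1) = Pi.single b δ) (hSb : S (Pi.single b δ) = -Pi.single a 1) (X : ℕ) :
    ∑' L : {L : AddSubgroup (Fin d → ℤ) // ∀ v ∈ L, S v ∈ L}, truncWeight X (d - 1) L.1.index ≤
      (2 * (1 + harmonicSum X)) ^ 2 * harmonicSum X ^ (d - 2) := by
  let ι : GaussianInt →+ (Fin d → ℤ) :=
    { toFun := fun z => z.re • Pi.single a 1 + z.im • Pi.single b δ
      map_zero' := by simp
      map_add' := fun z w => by simp only [Zsqrtd.re_add, Zsqrtd.im_add, add_smul]; abel }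
  let π : (Fin d → ℤ) →+ ({i // i ≠ a ∧ i ≠ b} → ℤ) :=
    { toFun := fun v i => v i.1
      map_zero' := rfl
      map_add' := fun _ _ => rfl }
  have hπ : Function.Surjective π := fun v =>
    ⟨fun i => if h : i ≠ a ∧ i ≠ b then v ⟨i, h⟩ else 0, by ext i; simp [π, i.2.1, i.2.2]⟩
  have hex : ι.range = π.ker := by
    ext v
    rw [AddMonoidHom.mem_ker]
    constructor
    · rintro ⟨z, rfl⟩
      ext i
      simp [ι, π, i.2.1, i.2.2]
    · intro hv
      refine ⟨⟨v a, δ * v b⟩, ?_⟩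
      ext i
      by_cases hia : i = a
      · subst hia; simp [ι, hab]
      · by_cases hib : i = b
        · subst hib
          simp [ι, hia]
          linear_combination v i * hδ
        · have := congrFun hv ⟨i, hia, hib⟩
          simpa [ι, hia, hib, π] using this.symm
  have hrank : Module.finrank ℤ ({i // i ≠ a ∧ i ≠ b} → ℤ) = d - 2 := by
    rw [Module.finrank_fintype_fun_eq_card, Fintype.card_subtype]
    have : (Finset.univ.filter fun i => i ≠ a ∧ i ≠ b) = ({a, b} : Finset (Fin d))ᶜ := by
      ext i; simp
    rw [this, Finset.card_compl, Finset.card_pair hab, Fintype.card_fin]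
  have hd : 2 ≤ d := by
    have := Finset.card_le_univ ({a, b} : Finset (Fin d))
    rwa [Finset.card_pair hab, Fintype.card_fin] at this
  have hι : ∀ z : GaussianInt, ι (⟨0, 1⟩ * z) = S (ι z) := fun z => by
    have : S (ι z) = z.re • Pi.single b δ + z.im • -Pi.single a 1 := by
      change S (z.re • Pi.single a 1 + z.im • Pi.single b δ) = _
      rw [map_add, map_zsmul, map_zsmul, hSa, hSb]
    rw [this]
    simp [ι]
    abel
  refine (tsum_truncWeight_index_le_of_exact hπ hex _
    (fun A => ∀ z ∈ A, (⟨0, 1⟩ : GaussianInt) * z ∈ A)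
    (fun L hL z hz => by
      rw [AddSubgroup.mem_comap, hι]; exact hL _ hz) (d - 2) X (d - 1)
    (AddSubgroup.exists_closure_range_eq hrank.le)).trans (mul_le_mul' ?_ ?_)
  · refine le_trans (ENNReal.tsum_le_tsum fun A => ?_) (tsum_truncWeight_index_gaussianInt_le X)
    exact pow_mul_truncWeight_le X _ (by omega)
  · exact (tsum_truncWeight_index_le X (d - 1) (by omega)).trans_eq (by rw [hrank])

/-- The endomorphism `T` of `ℤ^d` is a signed permutation with underlying permutation `τ`. -/
def IsSignedPermOver {d : ℕ} (T : AddMonoid.End (Fin d → ℤ)) (τ : Equiv.Perm (Fin d)) : Prop :=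
  ∃ ε : Fin d → ℤ, (∀ i, ε i = 1 ∨ ε i = -1) ∧ ∀ v i, T v i = ε i * v (τ i)

namespace IsSignedPermOver

variable {d : ℕ} {T : AddMonoid.End (Fin d → ℤ)} {τ : Equiv.Perm (Fin d)}

lemma neg (h : IsSignedPermOver T τ) : IsSignedPermOver (-T) τ := by
  obtain ⟨ε, hε, hT⟩ := h
  refine ⟨fun i => -ε i, fun i => ?_, fun v i => ?_⟩
  · rcases hε i with h | h <;> simp [h]
  · change -(T v i) = _
    rw [hT]; ring

lemma pow (h : IsSignedPermOver T τ) (n : ℕ) : IsSignedPermOver (T ^ n) (τ ^ n) := by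
  induction n with
  | zero => exact ⟨fun _ => 1, fun _ => Or.inl rfl, fun v i => (one_mul _).symm⟩
  | succ n ih =>
    obtain ⟨ε, hε, hT⟩ := h
    obtain ⟨η, hη, hTn⟩ := ih
    refine ⟨fun i => η i * ε ((τ ^ n) i), fun i => ?_, fun v i => ?_⟩
    · rcases hη i with h | h <;> rcases hε ((τ ^ n) i) with h' | h' <;> simp [h, h']
    · rw [pow_succ, pow_succ']
      change (T ^ n) (T v) i = _
      rw [hTn, hT, mul_assoc]
      rfl

lemma pow_two_mul_orderOf (h : IsSignedPermOver T τ) : T ^ (2 * orderOf τ) = 1 := by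
  obtain ⟨ε, hε, hT⟩ := h.pow (orderOf τ)
  rw [pow_orderOf_eq_one] at hT
  refine AddMonoidHom.ext fun v => funext fun i => ?_
  rw [two_mul, pow_add]
  change (T ^ orderOf τ) ((T ^ orderOf τ) v) i = v i
  rw [hT, hT]
  rcases hε i with h | h <;> simp [h]

lemma exists_pow_single (h : IsSignedPermOver T τ) (n : ℕ) (a : Fin d) :
    ∃ δ : ℤ, (δ = 1 ∨ δ = -1) ∧
      (T ^ n) (Pi.single a 1) = Pi.single ((τ ^ n)⁻¹ a) δ := by
  obtain ⟨ε, hε, hT⟩ := h.pow n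
  refine ⟨ε ((τ ^ n)⁻¹ a), hε _, funext fun i => ?_⟩
  rw [hT]
  by_cases hi : i = (τ ^ n)⁻¹ a
  · subst hi; simp
  · have : (τ ^ n) i ≠ a := fun h' => hi (Equiv.Perm.eq_inv_iff_eq.mpr h')
    rw [Pi.single_eq_of_ne hi, Pi.single_eq_of_ne this, mul_zero]

lemma exists_fixed (h : IsSignedPermOver T τ) (a : Fin d)
    (hk : (T ^ Function.minimalPeriod τ a) (Pi.single a 1) = Pi.single a 1) :
    ∃ u : Fin d → ℤ, u ≠ 0 ∧ T u = u := by
  set k := Function.minimalPeriod τ a with hkdef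
  have hkpos : 0 < k := Function.minimalPeriod_pos_of_mem_periodicPts
    (Function.Injective.mem_periodicPts τ.injective a)
  let N : AddMonoid.End (Fin d → ℤ) := ∑ i ∈ Finset.range k, T ^ i
  refine ⟨N (Pi.single a 1), fun h0 => ?_, ?_⟩
  · have h1 : N (Pi.single a 1) a = 1 := by
      rw [show N (Pi.single a 1) = ∑ i ∈ Finset.range k, (T ^ i) (Pi.single a 1) from
        AddMonoidHom.finsetSum_apply _ _ _, Finset.sum_apply,
        Finset.sum_eq_single_of_mem 0 (Finset.mem_range.mpr hkpos)]
      · simp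
      · intro i hi hi0
        obtain ⟨δ, -, hδ⟩ := h.exists_pow_single i a
        rw [hδ]
        refine Pi.single_eq_of_ne (fun h' => ?_) _
        have hper : Function.IsPeriodicPt τ i a := by
          rw [Function.IsPeriodicPt, Function.IsFixedPt, Equiv.Perm.iterate_eq_pow]
          exact (Equiv.Perm.eq_inv_iff_eq.mp h')
        exact absurd (hper.minimalPeriod_le (Nat.pos_of_ne_zero hi0))
          (not_le.mpr (Finset.mem_range.mp hi))
    rw [h0] at h1
    simp at h1
  · have h1 : (T - 1) * N = T ^ k - 1 := mul_geom_sum _ _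
    have h2 : T (N (Pi.single a 1)) - N (Pi.single a 1) =
        (T ^ k) (Pi.single a 1) - Pi.single a 1 := DFunLike.congr_fun h1 (Pi.single a 1)
    rw [hk, sub_self] at h2
    exact sub_eq_zero.mp h2

/-- A signed permutation either has an eigenvector for the eigenvalue `1` or `-1`, or some power
of it rotates a coordinate plane by a right angle. -/
lemma exists_fixed_or_rotation (h : IsSignedPermOver T τ) (a : Fin d) :
    (∃ u : Fin d → ℤ, u ≠ 0 ∧ T u = u) ∨ (∃ u : Fin d → ℤ, u ≠ 0 ∧ (-T) u = u) ∨
      ∃ (l : ℕ) (b : Fin d) (δ : ℤ), a ≠ b ∧ δ * δ = 1 ∧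
        (T ^ l) (Pi.single a 1) = Pi.single b δ ∧
        (T ^ l) (Pi.single b δ) = -Pi.single a 1 := by
  set k := Function.minimalPeriod τ a with hkdef
  have hkpos : 0 < k := Function.minimalPeriod_pos_of_mem_periodicPts
    (Function.Injective.mem_periodicPts τ.injective a)
  have hτk : (τ ^ k)⁻¹ a = a := by
    rw [Equiv.Perm.inv_eq_iff_eq, ← Equiv.Perm.iterate_eq_pow]
    exact (Function.isPeriodicPt_minimalPeriod τ a).symm
  obtain ⟨δ, hδ, hTk⟩ := h.exists_pow_single k a
  rw [hτk] at hTk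
  rcases hδ with rfl | rfl
  · exact Or.inl (h.exists_fixed a hTk)
  · rcases Nat.even_or_odd' k with ⟨l, hl | hl⟩
    · refine Or.inr (Or.inr ?_)
      obtain ⟨δ, hδ, hTl⟩ := h.exists_pow_single l a
      refine ⟨l, (τ ^ l)⁻¹ a, δ, fun h' => ?_, by rcases hδ with rfl | rfl <;> rfl, hTl, ?_⟩
      · have hper : Function.IsPeriodicPt τ l a := by
          rw [Function.IsPeriodicPt, Function.IsFixedPt, Equiv.Perm.iterate_eq_pow]
          exact (Equiv.Perm.eq_inv_iff_eq.mp h')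
        have := hper.minimalPeriod_le (by omega)
        omega
      · rw [← hTl, ← Pi.single_neg, ← hTk, hl, two_mul, pow_add]
        rfl
    · refine Or.inr (Or.inl (h.neg.exists_fixed a ?_))
      have hneg : (-T) ^ k = -(T ^ k) := Odd.neg_pow ⟨l, hl⟩ T
      rw [← hkdef, hneg]
      change -((T ^ k) (Pi.single a 1)) = _
      rw [hTk, Pi.single_neg, neg_neg]

lemma exists_tsum_truncWeight_index_stable_le (h : IsSignedPermOver T τ) (hd : 2 ≤ d)
    (hT : T ≠ 1) (hT' : -T ≠ 1) : ∃ K : ℕ, ∀ X : ℕ,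
      ∑' L : {L : AddSubgroup (Fin d → ℤ) // ∀ v ∈ L, T v ∈ L}, truncWeight X (d - 1) L.1.index ≤
        K * (1 + harmonicSum X) ^ d := by
  have hmono : ∀ S : AddMonoid.End (Fin d → ℤ),
      (∀ L : AddSubgroup (Fin d → ℤ), (∀ v ∈ L, T v ∈ L) → ∀ v ∈ L, S v ∈ L) → ∀ X : ℕ,
      ∑' L : {L : AddSubgroup (Fin d → ℤ) // ∀ v ∈ L, T v ∈ L}, truncWeight X (d - 1) L.1.index ≤
      ∑' L : {L : AddSubgroup (Fin d → ℤ) // ∀ v ∈ L, S v ∈ L}, truncWeight X (d - 1) L.1.index :=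
    fun S hS X => ENNReal.tsum_comp_le_tsum_of_injective
      (f := fun L : {L : AddSubgroup (Fin d → ℤ) // ∀ v ∈ L, T v ∈ L} =>
        (⟨L.1, hS L.1 L.2⟩ : {L : AddSubgroup (Fin d → ℤ) // ∀ v ∈ L, S v ∈ L}))
      (fun _ _ h => Subtype.ext (Subtype.mk.inj h))
      fun L => truncWeight X (d - 1) L.1.index
  have hfin : Module.finrank ℤ (Fin d → ℤ) = d := by simp
  have hfix : ∀ S : AddMonoid.End (Fin d → ℤ), IsSignedPermOver S τ → S ≠ 1 →
      (∀ L : AddSubgroup (Fin d → ℤ), (∀ v ∈ L, T v ∈ L) → ∀ v ∈ L, S v ∈ L) →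
      (∃ u : Fin d → ℤ, u ≠ 0 ∧ S u = u) → ∃ K : ℕ, ∀ X : ℕ,
      ∑' L : {L : AddSubgroup (Fin d → ℤ) // ∀ v ∈ L, T v ∈ L}, truncWeight X (d - 1) L.1.index ≤
        K * (1 + harmonicSum X) ^ d := by
    rintro S hSτ hS1 hS ⟨u, hu, hSu⟩
    refine ⟨(2 * orderOf τ) ^ (d * d), fun X => (hmono S hS X).trans ?_⟩
    have := tsum_truncWeight_index_stable_le_of_fixed S
      (Nat.mul_pos two_pos (orderOf_pos τ)) hSτ.pow_two_mul_orderOf hS1 hu hSu X (d - 1)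
      (by rw [hfin]; omega)
    rw [hfin] at this
    refine this.trans ?_
    gcongr
    exact le_add_self
  rcases h.exists_fixed_or_rotation ⟨0, by omega⟩ with hu | hu | ⟨l, b, δ, hab, hδ, h1, h2⟩
  · exact hfix T h hT (fun _ hL => hL) hu
  · exact hfix (-T) h.neg hT' (fun L hL v hv => L.neg_mem (hL v hv)) hu
  · refine ⟨4, fun X => (hmono (T ^ l) (fun L hL v hv => ?_) X).trans
      ((tsum_truncWeight_index_stable_le_of_rotation (T ^ l) hab hδ h1 h2 X).trans ?_)⟩
    · clear h1 h2
      induction l with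
      | zero => exact hv
      | succ l ih => rw [pow_succ']; exact hL _ ih
    · calc (2 * (1 + harmonicSum X)) ^ 2 * harmonicSum X ^ (d - 2)
          ≤ (2 * (1 + harmonicSum X)) ^ 2 * (1 + harmonicSum X) ^ (d - 2) := by
            gcongr
            exact le_add_self
        _ = ((4 : ℕ) : ℝ≥0∞) * ((1 + harmonicSum X) ^ 2 * (1 + harmonicSum X) ^ (d - 2)) := by
            push_cast; ring
        _ = _ := by rw [← pow_add, Nat.add_sub_cancel' hd]

end IsSignedPermOver

lemma harmonicSum_floor_le {x : ℝ} (hx : 1 ≤ x) :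
    harmonicSum ⌊x⌋₊ ≤ ENNReal.ofReal (1 + Real.log x) := by
  have h1 : harmonicSum ⌊x⌋₊ = ENNReal.ofReal (harmonic ⌊x⌋₊ : ℚ) := by
    rw [harmonicSum, tsum_eq_sum (s := Finset.Icc 1 ⌊x⌋₊), harmonic_eq_sum_Icc, Rat.cast_sum,
      ENNReal.ofReal_sum_of_nonneg]
    · refine Finset.sum_congr rfl fun n hn => ?_
      rw [Finset.mem_Icc] at hn
      rw [truncWeight, if_pos hn, pow_one, Rat.cast_inv, Rat.cast_natCast,
        ENNReal.ofReal_inv_of_pos (by exact_mod_cast hn.1), ENNReal.ofReal_natCast]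
    · intro n _
      positivity
    · intro n hn
      rw [Finset.mem_Icc] at hn
      rw [truncWeight, if_neg hn]
  rw [h1]
  exact ENNReal.ofReal_le_ofReal (harmonic_floor_le_one_add_log x hx)

lemma log_pow_le_rpow_div_log_log {x : ℝ} (hx : 16 ≤ x) (d : ℕ) :
    Real.log x ^ d ≤ x ^ (4 * d / Real.log (Real.log x)) := by
  have hx0 : 0 < x := by linarith
  have hL : 1 < Real.log x := by
    rw [Real.lt_log_iff_exp_lt hx0]
    linarith [Real.exp_one_lt_d9]
  have hl : 0 < Real.log (Real.log x) := Real.log_pos hL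
  have hsq : Real.log (Real.log x) ^ 2 ≤ 4 * Real.log x := by
    have h1 : Real.log (Real.log x) = 2 * Real.log √(Real.log x) := by
      rw [Real.log_sqrt (by linarith)]; ring
    have h2 : Real.log √(Real.log x) ≤ √(Real.log x) := Real.log_le_self (Real.sqrt_nonneg _)
    have h3 : 0 ≤ Real.log √(Real.log x) := by linarith
    calc Real.log (Real.log x) ^ 2 = 4 * Real.log √(Real.log x) ^ 2 := by rw [h1]; ring
      _ ≤ 4 * √(Real.log x) ^ 2 := by gcongr
      _ = 4 * Real.log x := by rw [Real.sq_sqrt (by linarith)]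
  rw [Real.rpow_def_of_pos hx0, ← Real.rpow_natCast, Real.rpow_def_of_pos (by linarith)]
  refine Real.exp_le_exp.mpr ?_
  rw [mul_div_assoc', le_div_iff₀ hl]
  nlinarith [mul_le_mul_of_nonneg_left hsq (Nat.cast_nonneg (α := ℝ) d)]

/-- **Theorem (few sublattices are invariant under a nontrivial signed permutation).**
Let `d ≥ 2` and let `σ ∈ B_d` with `σ ≠ Id` and `σ ≠ −Id`. Then there is `C > 0` such that for
all `x ≥ 16`, the number of finite-index subgroups `L ≤ ℤ^d` of index at most `x` with
`σ(L) = L` is at most `C·x^{d−1+C/log log x}`. -/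
theorem few_invariant_sublattices (d : ℕ) (hd : 2 ≤ d)
    (σ : (Fin d → ℤ) → (Fin d → ℤ)) (hσ : IsSignedPerm d σ)
    (hId : ∃ v : Fin d → ℤ, σ v ≠ v) (hnegId : ∃ v : Fin d → ℤ, σ v ≠ -v) :
    ∃ C : ℝ, 0 < C ∧ ∀ x : ℝ, 16 ≤ x →
      (Nat.card {L : AddSubgroup (Fin d → ℤ) //
          L.index ≠ 0 ∧ (L.index : ℝ) ≤ x ∧ ∀ v : Fin d → ℤ, σ v ∈ L ↔ v ∈ L} : ℝ) ≤
        C * x ^ ((d : ℝ) - 1 + C / Real.log (Real.log x)) := by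
  obtain ⟨τ, ε, hε, hστ⟩ := hσ
  let T : AddMonoid.End (Fin d → ℤ) :=
    { toFun := σ
      map_zero' := by ext i; simp [hστ]
      map_add' := fun v w => by ext i; simp [hστ, mul_add] }
  have hTτ : IsSignedPermOver T τ := ⟨ε, hε, hστ⟩
  have hT1 : T ≠ 1 := fun h => by
    obtain ⟨v, hv⟩ := hId
    exact hv (DFunLike.congr_fun h v)
  have hT2 : -T ≠ 1 := fun h => by
    obtain ⟨v, hv⟩ := hnegId
    exact hv (neg_eq_iff_eq_neg.mp (DFunLike.congr_fun h v))
  obtain ⟨K, hK⟩ := hTτ.exists_tsum_truncWeight_index_stable_le hd hT1 hT2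
  refine ⟨K * 2 ^ d + 4 * d, by positivity, fun x hx => ?_⟩
  have hx0 : 0 < x := by linarith
  have hL : 2 ≤ Real.log x := by
    have h : Real.log 16 = 4 * Real.log 2 := by
      rw [show (16 : ℝ) = 2 ^ 4 by norm_num, Real.log_pow]; norm_num
    have := Real.log_le_log (by norm_num) hx
    linarith [Real.log_two_gt_d9]
  have hl : 0 < Real.log (Real.log x) := Real.log_pos (by linarith)
  set S := {L : AddSubgroup (Fin d → ℤ) //
    L.index ≠ 0 ∧ (L.index : ℝ) ≤ x ∧ ∀ v : Fin d → ℤ, σ v ∈ L ↔ v ∈ L}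
  have hcard : (Nat.card S : ℝ≥0∞) ≤
      ENNReal.ofReal (x ^ (d - 1) * (K * (1 + (1 + Real.log x)) ^ d)) := by
    have hweight : ∀ L : S, 1 ≤ ENNReal.ofReal x ^ (d - 1) *
        truncWeight ⌊x⌋₊ (d - 1) L.1.index := fun ⟨L, h0, hLx, _⟩ => by
      rw [truncWeight, if_pos ⟨Nat.one_le_iff_ne_zero.mpr h0, Nat.le_floor hLx⟩]
      have hn : (L.index : ℝ≥0∞) ≤ ENNReal.ofReal x := by
        rw [← ENNReal.ofReal_natCast]; exact ENNReal.ofReal_le_ofReal hLx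
      rw [← div_eq_mul_inv, ENNReal.le_div_iff_mul_le
        (Or.inl (pow_ne_zero _ (Nat.cast_ne_zero.mpr h0))) (Or.inl (ENNReal.pow_ne_top (by simp))),
        one_mul]
      gcongr
    have hstab : ∀ L : AddSubgroup (Fin d → ℤ), (L.index ≠ 0 ∧ (L.index : ℝ) ≤ x ∧
        ∀ v : Fin d → ℤ, σ v ∈ L ↔ v ∈ L) → ∀ v ∈ L, T v ∈ L :=
      fun L h v hv => (h.2.2 v).mpr hv
    calc (Nat.card S : ℝ≥0∞) ≤ ENat.card S := by
          rw [Nat.card]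
          exact_mod_cast ENat.natCast_toNat_le_self _
      _ = ∑' _ : S, 1 := ENNReal.tsum_one.symm
      _ ≤ ∑' L : S, ENNReal.ofReal x ^ (d - 1) * truncWeight ⌊x⌋₊ (d - 1) L.1.index :=
          ENNReal.tsum_le_tsum hweight
      _ = ENNReal.ofReal x ^ (d - 1) * ∑' L : S, truncWeight ⌊x⌋₊ (d - 1) L.1.index :=
          ENNReal.tsum_mul_left
      _ ≤ ENNReal.ofReal x ^ (d - 1) *
            ∑' L : {L : AddSubgroup (Fin d → ℤ) // ∀ v ∈ L, T v ∈ L},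
              truncWeight ⌊x⌋₊ (d - 1) L.1.index := by
          gcongr
          exact ENNReal.tsum_comp_le_tsum_of_injective
            (f := fun L : S => (⟨L.1, hstab L.1 L.2⟩ :
              {L : AddSubgroup (Fin d → ℤ) // ∀ v ∈ L, T v ∈ L}))
            (fun _ _ h => Subtype.ext (Subtype.mk.inj h))
            fun L => truncWeight ⌊x⌋₊ (d - 1) L.1.index
      _ ≤ ENNReal.ofReal x ^ (d - 1) * (K * (1 + ENNReal.ofReal (1 + Real.log x)) ^ d) := by
          gcongr
          refine (hK _).trans ?_
          gcongr
          exact harmonicSum_floor_le (by linarith)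
      _ = _ := by
          rw [ENNReal.ofReal_mul (by positivity), ENNReal.ofReal_mul (by positivity),
            ENNReal.ofReal_pow hx0.le, ENNReal.ofReal_natCast, ENNReal.ofReal_pow (by linarith),
            ENNReal.ofReal_add one_pos.le (by linarith : 0 ≤ 1 + Real.log x), ENNReal.ofReal_one]
  rw [← ENNReal.ofReal_natCast, ENNReal.ofReal_le_ofReal_iff (by positivity)] at hcard
  have hexp : x ^ ((d : ℝ) - 1 + (K * 2 ^ d + 4 * d) / Real.log (Real.log x)) =
      x ^ (d - 1) * x ^ ((K * 2 ^ d + 4 * d) / Real.log (Real.log x)) := by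
    rw [Real.rpow_add hx0, ← Real.rpow_natCast x, Nat.cast_sub (by omega), Nat.cast_one]
  rw [hexp]
  calc (Nat.card S : ℝ) ≤ x ^ (d - 1) * (K * (1 + (1 + Real.log x)) ^ d) := hcard
    _ ≤ x ^ (d - 1) * (K * (2 * Real.log x) ^ d) := by gcongr; linarith
    _ = x ^ (d - 1) * (K * 2 ^ d * Real.log x ^ d) := by rw [mul_pow]; ring
    _ ≤ x ^ (d - 1) * ((K * 2 ^ d + 4 * d) *
          x ^ ((K * 2 ^ d + 4 * d) / Real.log (Real.log x))) := by
        gcongr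
        · linarith [Nat.cast_nonneg (α := ℝ) d]
        · refine (log_pow_le_rpow_div_log_log hx d).trans
            (Real.rpow_le_rpow_of_exponent_le (by linarith) ?_)
          gcongr
          linarith [show (0 : ℝ) ≤ K * 2 ^ d by positivity]
    _ = _ := by ring
end

section
/- Let d ≥ 2 and r ∈ ℕ. Then there exists a real C > 0 (depending only on d and r) such that for every real x ≥ 2, the number of sublattices L of ℤ^d with index at most x that contain a nonzero vector u with ℓ1-norm ‖u‖₁ ≤ r is at most C·x^{d−1}·log x. -/
/-- The subgroups of nonzero finite index at most `N`. -/
def AddSubgroup.indexLE (G : Type*) [AddCommGroup G] (N : ℕ) : Set (AddSubgroup G) :=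
  {L | L.index ≠ 0 ∧ L.index ≤ N}

open AddSubgroup

lemma AddSubgroup.index_comap_inr_mul_index_map_fst {A H : Type*} [AddCommGroup A]
    [AddCommGroup H] (L : AddSubgroup (A × H)) :
    (L.comap (AddMonoidHom.inr A H)).index * (L.map (AddMonoidHom.fst A H)).index = L.index := by
  have hker : (AddMonoidHom.fst A H).ker = (AddMonoidHom.inr A H).range := by
    ext ⟨a, h⟩
    exact ⟨fun ha ↦ ⟨h, Prod.ext (Eq.symm ha) rfl⟩, fun ⟨_, hh⟩ ↦ (congrArg Prod.fst hh).symm⟩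
  rw [index_comap, index_map, (AddMonoidHom.fst A H).range_eq_top_of_surjective Prod.fst_surjective,
    index_top, mul_one, hker, ← relIndex_sup_right, sup_comm, relIndex_mul_index le_sup_left]

/-- A subgroup `L` of `ℤ × H` is determined by `L ∩ H`, the generator `b` of its projection to
`ℤ`, and the class modulo `L ∩ H` of any `h` with `(b, h) ∈ L`. -/
lemma AddSubgroup.exists_eq_comap_zmultiples {H : Type*} [AddCommGroup H]
    (L : AddSubgroup (ℤ × H)) :
    ∃ c : H ⧸ L.comap (AddMonoidHom.inr ℤ H),
      L = (zmultiples (((L.map (AddMonoidHom.fst ℤ H)).index : ℤ), c)).comap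
        ((AddMonoidHom.id ℤ).prodMap
          (QuotientAddGroup.mk' (L.comap (AddMonoidHom.inr ℤ H)))) := by
  obtain ⟨b, hb⟩ : ∃ b : ℕ, L.map (AddMonoidHom.fst ℤ H) = zmultiples (b : ℤ) := by
    obtain ⟨a, ha⟩ := Int.subgroup_cyclic (L.map (AddMonoidHom.fst ℤ H))
    refine ⟨a.natAbs, ?_⟩
    rw [ha, ← zmultiples_eq_closure, Int.zmultiples_natAbs]
  have hmem : (b : ℤ) ∈ L.map (AddMonoidHom.fst ℤ H) := hb ▸ mem_zmultiples _
  obtain ⟨⟨b', h⟩, hL, hbb⟩ := hmem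
  obtain rfl : b' = b := hbb
  have key (k : ℤ) (y : H) : (k * b, y) ∈ L ↔ -(k • h) + y ∈ L.comap (AddMonoidHom.inr ℤ H) := by
    have : (k * (b : ℤ), y) = k • ((b : ℤ), h) + (0, -(k • h) + y) := by simp
    rw [this, L.add_mem_cancel_left (L.zsmul_mem hL k)]
    rfl
  refine ⟨(h : H ⧸ L.comap (AddMonoidHom.inr ℤ H)), ?_⟩
  rw [hb, Int.index_zmultiples, Int.natAbs_natCast]
  ext ⟨z, y⟩
  simp only [mem_comap, mem_zmultiples_iff, AddMonoidHom.prodMap_def, AddMonoidHom.prod_apply,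
    AddMonoidHom.coe_comp, Function.comp_apply, AddMonoidHom.coe_fst, AddMonoidHom.coe_snd,
    AddMonoidHom.id_apply, QuotientAddGroup.mk'_apply, Prod.smul_mk, Prod.mk.injEq, smul_eq_mul]
  constructor
  · intro hzy
    have hz : z ∈ zmultiples (b : ℤ) := hb ▸ ⟨_, hzy, rfl⟩
    obtain ⟨k, rfl⟩ := mem_zmultiples_iff.1 hz
    exact ⟨k, rfl, QuotientAddGroup.eq.2 ((key k y).1 hzy)⟩
  · rintro ⟨k, rfl, hk⟩
    exact (key k y).2 (QuotientAddGroup.eq.1 hk)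

lemma AddSubgroup.indexLE_int_prod {H : Type*} [AddCommGroup H] {N : ℕ}
    (hfin : (indexLE H N).Finite) :
    (indexLE (ℤ × H) N).Finite ∧ (indexLE (ℤ × H) N).ncard ≤ N * (indexLE H N).ncard := by
  have := hfin.to_subtype
  have hq (K : indexLE H N) : Finite (H ⧸ K.1) := by
    have : K.1.FiniteIndex := ⟨K.2.1⟩
    infer_instance
  let g : (Σ K : indexLE H N, Fin (N / K.1.index) × (H ⧸ K.1)) → AddSubgroup (ℤ × H) := fun p ↦
    (zmultiples (((p.2.1 + 1 : ℕ) : ℤ), p.2.2)).comap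
      ((AddMonoidHom.id ℤ).prodMap (QuotientAddGroup.mk' p.1.1))
  have hsub : indexLE (ℤ × H) N ⊆ Set.range g := by
    rintro L ⟨h0, hN⟩
    obtain ⟨c, hc⟩ := L.exists_eq_comap_zmultiples
    have hmul := L.index_comap_inr_mul_index_map_fst
    let K := L.comap (AddMonoidHom.inr ℤ H)
    let b := (L.map (AddMonoidHom.fst ℤ H)).index
    rw [← hmul] at h0 hN
    obtain ⟨hK, hb⟩ : K.index ≠ 0 ∧ b ≠ 0 := mul_ne_zero_iff.1 h0
    have hbN : b ≤ N / K.index :=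
      (Nat.le_div_iff_mul_le (Nat.pos_of_ne_zero hK)).2 (by rwa [mul_comm])
    refine ⟨⟨⟨K, hK, (Nat.le_mul_of_pos_right _ (Nat.pos_of_ne_zero hb)).trans hN⟩,
      ⟨b - 1, (Nat.sub_one_lt hb).trans_le hbN⟩, c⟩, ?_⟩
    simp only [g, Nat.sub_add_cancel (Nat.pos_of_ne_zero hb)]
    exact hc.symm
  refine ⟨(Set.finite_range g).subset hsub, ?_⟩
  have := Fintype.ofFinite (indexLE H N)
  calc (indexLE (ℤ × H) N).ncard ≤ (Set.range g).ncard := Set.ncard_le_ncard hsub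
    _ ≤ Nat.card (Σ K : indexLE H N, Fin (N / K.1.index) × (H ⧸ K.1)) := Finite.card_range_le g
    _ = ∑ K : indexLE H N, N / K.1.index * K.1.index := by
      rw [Nat.card_sigma]
      simp [Nat.card_prod, AddSubgroup.index]
    _ ≤ ∑ _K : indexLE H N, N := Finset.sum_le_sum fun K _ ↦ Nat.div_mul_le_self _ _
    _ = N * (indexLE H N).ncard := by
      rw [Finset.sum_const, Finset.card_univ, smul_eq_mul, mul_comm, ← Nat.card_eq_fintype_card,
        Nat.card_coe_set_eq]

lemma AddSubgroup.indexLE_of_surjective {G H : Type*} [AddCommGroup G] [AddCommGroup H] {N : ℕ}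
    (f : G →+ H) (hf : Function.Surjective f) (hfin : (indexLE G N).Finite) :
    (indexLE H N).Finite ∧ (indexLE H N).ncard ≤ (indexLE G N).ncard := by
  have hmaps : ∀ L ∈ indexLE H N, L.comap f ∈ indexLE G N := fun L hL ↦ by
    rwa [indexLE, Set.mem_ofPred_eq, index_comap_of_surjective L hf]
  have hinj := comap_injective hf
  exact ⟨hfin.of_injOn hmaps hinj.injOn,
    Set.ncard_le_ncard_of_injOn _ hmaps hinj.injOn hfin⟩

lemma AddSubgroup.indexLE_pi_int_prod (A : Type*) [AddCommGroup A] [Finite A] (n N : ℕ) :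
    (indexLE ((Fin n → ℤ) × A) N).Finite ∧
      (indexLE ((Fin n → ℤ) × A) N).ncard ≤ Nat.card (AddSubgroup A) * N ^ n := by
  induction n with
  | zero =>
    have := indexLE_of_surjective (N := N) (AddMonoidHom.inr (Fin 0 → ℤ) A)
      (fun ⟨v, a⟩ ↦ ⟨a, Prod.ext (Subsingleton.elim _ _) rfl⟩) (Set.toFinite _)
    refine ⟨this.1, this.2.trans ?_⟩
    simpa using Set.ncard_le_card _
  | succ n ih =>
    have h := indexLE_int_prod ih.1
    let f : ℤ × ((Fin n → ℤ) × A) →+ (Fin (n + 1) → ℤ) × A :=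
      AddMonoidHom.mk' (fun p ↦ (Fin.cons p.1 p.2.1, p.2.2)) fun p q ↦
        Prod.ext (funext (Fin.cases rfl fun _ ↦ rfl)) rfl
    have h' := indexLE_of_surjective f
      (fun ⟨v, a⟩ ↦ ⟨(v 0, (Fin.tail v, a)), Prod.ext (Fin.cons_self_tail v) rfl⟩) h.1
    refine ⟨h'.1, h'.2.trans (h.2.trans ((Nat.mul_le_mul_left N ih.2).trans_eq ?_))⟩
    ring

/-- A finitely generated abelian group of rank `m` has `O(N ^ m)` subgroups of index at most
`N`. -/
lemma AddSubgroup.exists_ncard_indexLE_le (G : Type*) [AddCommGroup G] [Module.Finite ℤ G] :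
    ∃ C : ℕ, ∀ N : ℕ, (indexLE G N).Finite ∧
      (indexLE G N).ncard ≤ C * N ^ Module.finrank ℤ G := by
  obtain ⟨n, ι, _, p, hp, e, ⟨g⟩⟩ := AddCommGroup.equiv_free_prod_directSum_zmod G
    (hG := Module.Finite.iff_addGroup_fg.1 ‹_›)
  have (i : ι) : NeZero (p i ^ e i) := ⟨pow_ne_zero _ (hp i).ne_zero⟩
  set A := DirectSum ι fun i ↦ ZMod (p i ^ e i)
  have : Finite A := Finite.of_equiv _ DFinsupp.equivFunOnFintype.symm
  let g' : ((Fin n → ℤ) × A) ≃+ G :=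
    ((Finsupp.linearEquivFunOnFinite ℤ ℤ (Fin n)).symm.toAddEquiv.prodCongr
      (AddEquiv.refl A)).trans g.symm
  have hrank : Module.finrank ℤ G = n := by
    let q : G →ₗ[ℤ] (Fin n → ℤ) :=
      LinearMap.fst ℤ _ _ ∘ₗ g'.symm.toIntLinearEquiv.toLinearMap
    have hq : Function.Surjective q := Prod.fst_surjective.comp g'.symm.surjective
    have htors : Module.IsTorsion ℤ (LinearMap.ker q) := by
      rintro ⟨x, hx⟩
      have hx : (g'.symm x).1 = 0 := hx
      refine ⟨⟨Nat.card A, mem_nonZeroDivisors_of_ne_zero (mod_cast Nat.card_pos.ne')⟩,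
        Subtype.ext (g'.symm.injective ?_)⟩
      change g'.symm ((Nat.card A : ℤ) • x) = g'.symm 0
      rw [natCast_zsmul, map_nsmul, map_zero]
      exact Prod.ext (by rw [Prod.smul_fst, hx, smul_zero, Prod.fst_zero]) (card_nsmul_eq_zero' ..)
    have h := Submodule.finrank_quotient_add_finrank (LinearMap.ker q)
    rwa [Module.finrank_eq_zero_iff_isTorsion.2 htors,
      (q.quotKerEquivOfSurjective hq).finrank_eq, Module.finrank_fin_fun, add_zero, eq_comm] at h
  refine ⟨Nat.card (AddSubgroup A), fun N ↦ ?_⟩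
  have h := indexLE_pi_int_prod A n N
  have h' := indexLE_of_surjective g'.toAddMonoidHom g'.surjective h.1
  exact ⟨h'.1, hrank ▸ h'.2.trans h.2⟩

lemma AddSubgroup.exists_ncard_indexLE_mem_le {d : ℕ} {u : Fin d → ℤ} (hu : u ≠ 0) :
    ∃ C : ℕ, ∀ N : ℕ, {L ∈ indexLE (Fin d → ℤ) N | u ∈ L}.Finite ∧
      {L ∈ indexLE (Fin d → ℤ) N | u ∈ L}.ncard ≤ C * N ^ (d - 1) := by
  let S : Submodule ℤ (Fin d → ℤ) := Submodule.span ℤ {u}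
  have hrank : Module.finrank ℤ ((Fin d → ℤ) ⧸ S) = d - 1 := by
    have h1 := Submodule.finrank_quotient_add_finrank S
    have h2 : Module.finrank ℤ S = 1 := by
      rw [← (LinearEquiv.toSpanNonzeroSingleton ℤ _ u hu).finrank_eq, Module.finrank_self]
    rw [h2, Module.finrank_fin_fun] at h1
    omega
  obtain ⟨C, hC⟩ := exists_ncard_indexLE_le ((Fin d → ℤ) ⧸ S)
  rw [hrank] at hC
  refine ⟨C, fun N ↦ ?_⟩
  let f : (Fin d → ℤ) →+ (Fin d → ℤ) ⧸ S := S.mkQ.toAddMonoidHom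
  have hf : Function.Surjective f := S.mkQ_surjective
  have hsub : {L ∈ indexLE (Fin d → ℤ) N | u ∈ L} ⊆ comap f '' indexLE _ N := by
    rintro L ⟨hL, huL⟩
    have hker : f.ker ≤ L := by
      intro v hv
      have hv : v ∈ S := (Submodule.Quotient.mk_eq_zero S).1 hv
      obtain ⟨k, rfl⟩ := Submodule.mem_span_singleton.1 hv
      exact L.zsmul_mem huL k
    have hL' : (L.map f).comap f = L := comap_map_eq_self hker
    refine ⟨L.map f, ?_, hL'⟩
    rwa [indexLE, Set.mem_ofPred_eq, ← index_comap_of_surjective _ hf, hL']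
  have hfin := (hC N).1.image (comap f)
  exact ⟨hfin.subset hsub, (Set.ncard_le_ncard hsub hfin).trans
    ((Set.ncard_image_le (hC N).1).trans (hC N).2)⟩

/-- **Theorem (few sublattices have small minimum distance).**
Let `d ≥ 2` and `r ∈ ℕ`. There is `C > 0` such that for all `x ≥ 2`, the number of finite-index
subgroups `L ≤ ℤ^d` of index at most `x` containing a nonzero vector `u` with `‖u‖₁ ≤ r` is at
most `C·x^{d−1}·log x`. -/
theorem few_sublattices_small_min_distance (d r : ℕ) (hd : 2 ≤ d) :
    ∃ C : ℝ, 0 < C ∧ ∀ x : ℝ, 2 ≤ x →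
      (Nat.card {L : AddSubgroup (Fin d → ℤ) //
          L.index ≠ 0 ∧ (L.index : ℝ) ≤ x ∧
          ∃ u : Fin d → ℤ, u ∈ L ∧ u ≠ 0 ∧ (∑ i, |u i|) ≤ (r : ℤ)} : ℝ) ≤
        C * x ^ (d - 1) * Real.log x := by
  classical
  have hU : {u : Fin d → ℤ | u ≠ 0 ∧ ∑ i, |u i| ≤ (r : ℤ)}.Finite := by
    refine (Set.finite_Icc (fun _ ↦ -(r : ℤ)) (fun _ ↦ (r : ℤ))).subset ?_
    rintro u ⟨-, hu⟩
    have h (i : Fin d) : |u i| ≤ r :=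
      (Finset.single_le_sum (fun j _ ↦ abs_nonneg (u j)) (Finset.mem_univ i)).trans hu
    exact ⟨fun i ↦ (abs_le.1 (h i)).1, fun i ↦ (abs_le.1 (h i)).2⟩
  choose! c hc using fun (u : Fin d → ℤ) (hu : u ≠ 0) ↦ exists_ncard_indexLE_mem_le hu
  have hlog2 : 0 < Real.log 2 := Real.log_pos one_lt_two
  set C := ∑ u ∈ hU.toFinset, c u
  refine ⟨(C + 1) / Real.log 2, by positivity, fun x hx ↦ ?_⟩
  set N := ⌊x⌋₊
  have hx0 : 0 ≤ x := by linarith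
  have hfin (u) (hu : u ∈ hU.toFinset) := (hc u (hU.mem_toFinset.1 hu).1 N).1
  have hsub : {L : AddSubgroup (Fin d → ℤ) | L.index ≠ 0 ∧ (L.index : ℝ) ≤ x ∧
      ∃ u : Fin d → ℤ, u ∈ L ∧ u ≠ 0 ∧ (∑ i, |u i|) ≤ (r : ℤ)} ⊆
      ⋃ u ∈ hU.toFinset, {L ∈ indexLE (Fin d → ℤ) N | u ∈ L} := by
    rintro L ⟨h0, hLx, u, huL, hu⟩
    exact Set.mem_biUnion (hU.mem_toFinset.2 hu) ⟨⟨h0, Nat.le_floor hLx⟩, huL⟩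
  have hcard : Nat.card {L : AddSubgroup (Fin d → ℤ) // L.index ≠ 0 ∧ (L.index : ℝ) ≤ x ∧
      ∃ u : Fin d → ℤ, u ∈ L ∧ u ≠ 0 ∧ (∑ i, |u i|) ≤ (r : ℤ)} ≤ C * N ^ (d - 1) := by
    refine (Set.ncard_le_ncard hsub (hU.toFinset.finite_toSet.biUnion hfin)).trans ?_
    refine (Finset.set_ncard_biUnion_le _ _).trans ?_
    rw [Finset.sum_mul]
    exact Finset.sum_le_sum fun u hu ↦ (hc u (hU.mem_toFinset.1 hu).1 N).2
  calc (Nat.card _ : ℝ) ≤ C * N ^ (d - 1) := mod_cast hcard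
    _ ≤ (C + 1) * x ^ (d - 1) * 1 := by
      rw [mul_one]
      gcongr
      · linarith
      · exact Nat.floor_le hx0
    _ ≤ (C + 1) * x ^ (d - 1) * (Real.log x / Real.log 2) := by
      gcongr
      rw [one_le_div hlog2]
      exact Real.log_le_log two_pos hx
    _ = _ := by ring
end
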